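/- arXiv:2307.06897 — 2 statements merged into one kernel-verified Lean document; each statement's English description precedes it below -/
import Mathlib

section
/- For every nondeterministic Büchi automaton B over a finite alphabet Σ there exists a deterministic Rabin automaton D over Σ recognizing the same ω-language, i.e., for every infinite word w : ℕ → Σ, B has an accepting run on w if and only if the unique run of D on w satisfies the Rabin acceptance condition. -/
open Filter

/-- A nondeterministic Büchi automaton over alphabet `A`. -/
structure NBA (A : Type) where
  Q : Type
  [fin : Fintype Q]
  Δ : Q → A → Set Q
  qI : Q
  F : Set Q

attribute [instance] NBA.fin

/-- A run of a nondeterministic Büchi automaton on an infinite word. -/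
def NBA.IsRun {A : Type} (B : NBA A) (w : ℕ → A) (ρ : ℕ → B.Q) : Prop :=
  ρ 0 = B.qI ∧ ∀ i, ρ (i + 1) ∈ B.Δ (ρ i) (w i)

/-- Acceptance for a nondeterministic Büchi automaton: there is a run visiting
accepting states infinitely often. -/
def NBA.Accepts {A : Type} (B : NBA A) (w : ℕ → A) : Prop :=
  ∃ ρ : ℕ → B.Q, B.IsRun w ρ ∧ ∃ᶠ i in atTop, ρ i ∈ B.F

/-- A deterministic Rabin automaton over alphabet `A`. -/
structure DRA (A : Type) where
  Q : Type
  [fin : Fintype Q]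
  δ : Q → A → Q
  qI : Q
  R : Finset (Set Q × Set Q)

attribute [instance] DRA.fin

/-- The unique run of a deterministic Rabin automaton on an infinite word. -/
def DRA.run {A : Type} (D : DRA A) (w : ℕ → A) : ℕ → D.Q
  | 0 => D.qI
  | i + 1 => D.δ (D.run w i) (w i)

/-- Rabin acceptance: for some pair `(E, G)` in the condition, the run visits `G`
infinitely often and `E` only finitely often. -/
def DRA.Accepts {A : Type} (D : DRA A) (w : ℕ → A) : Prop :=
  ∃ p ∈ D.R, (∃ᶠ i in atTop, D.run w i ∈ p.2) ∧ (∀ᶠ i in atTop, D.run w i ∉ p.1)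

/-! ### Values of infixes -/

/-- The state reached after reading `w p, …, w (n - 1)` from `s₀`. -/
def valueFrom {A S : Type} (step : S → A → S) (s₀ : S) (w : ℕ → A) (p : ℕ) : ℕ → S
  | 0 => s₀
  | n + 1 => if p ≤ n then step (valueFrom step s₀ w p n) (w n) else s₀

section ValueFrom

variable {A S : Type} {step : S → A → S} {s₀ : S} {w : ℕ → A}

theorem valueFrom_succ {p n : ℕ} (h : p ≤ n) :
    valueFrom step s₀ w p (n + 1) = step (valueFrom step s₀ w p n) (w n) :=
  if_pos h

theorem valueFrom_of_le {p n : ℕ} (h : n ≤ p) : valueFrom step s₀ w p n = s₀ := by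
  cases n with
  | zero => rfl
  | succ n => exact if_neg (by omega)

theorem valueFrom_self_succ (p : ℕ) : valueFrom step s₀ w p (p + 1) = step s₀ (w p) := by
  rw [valueFrom_succ le_rfl, valueFrom_of_le le_rfl]

theorem valueFrom_eq_of_le {p r n m : ℕ} (hp : p ≤ n) (hr : r ≤ n)
    (h : valueFrom step s₀ w p n = valueFrom step s₀ w r n) (hnm : n ≤ m) :
    valueFrom step s₀ w p m = valueFrom step s₀ w r m := by
  induction m, hnm using Nat.le_induction with
  | base => exact h
  | succ m hm ih => rw [valueFrom_succ (hp.trans hm), valueFrom_succ (hr.trans hm), ih]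

variable (step s₀ w) in
/-- The position `p` lies after `r`, the infix from `r` to `p` has value `e`, and the infixes
starting at `p` and at `r` eventually have the same values. -/
def MergesInto (r : ℕ) (e : S) (p : ℕ) : Prop :=
  r < p ∧ valueFrom step s₀ w r p = e ∧
    ∀ᶠ m in atTop, valueFrom step s₀ w p m = valueFrom step s₀ w r m

theorem MergesInto.exists_chain {r p₀ : ℕ} {e : S}
    (h : ∃ᶠ p in atTop, MergesInto step s₀ w r e p) (h₀ : MergesInto step s₀ w r e p₀) :
    ∃ p : ℕ → ℕ, p 0 = p₀ ∧ StrictMono p ∧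
      ∀ k, valueFrom step s₀ w (p k) (p (k + 1)) = e := by
  have next : ∀ p : {p // MergesInto step s₀ w r e p}, ∃ q : {p // MergesInto step s₀ w r e p},
      p.1 < q.1 ∧ valueFrom step s₀ w p q = e := by
    rintro ⟨p, hp⟩
    obtain ⟨q, hq, hpq, hlt⟩ := (h.and_eventually (hp.2.2.and (eventually_gt_atTop p))).exists
    exact ⟨⟨q, hq⟩, hlt, hpq.trans hq.2.1⟩
  choose f hlt hf using next
  refine ⟨fun k => (f^[k] ⟨p₀, h₀⟩).1, rfl, strictMono_nat_of_lt_succ fun k => ?_, fun k => ?_⟩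
  · simp only [Function.iterate_succ_apply']
    exact hlt _
  · simp only [Function.iterate_succ_apply']
    exact hf _

variable (step s₀ w) in
theorem exists_frequently_eventually_eq [Finite S] :
    ∃ r, ∃ᶠ p in atTop, ∀ᶠ m in atTop, valueFrom step s₀ w p m = valueFrom step s₀ w r m := by
  have hlim : ∀ p, ∃ s, ∀ᶠ m in (hyperfilter ℕ : Filter ℕ), valueFrom step s₀ w p m = s :=
    fun p => Ultrafilter.eventually_exists_iff.1 (Eventually.of_forall fun m => ⟨_, rfl⟩)
  choose lim hlim using hlim
  obtain ⟨s, hs⟩ : ∃ s, ∃ᶠ p in atTop, lim p = s :=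
    frequently_exists.1 (Eventually.of_forall fun p => ⟨lim p, rfl⟩).frequently
  obtain ⟨r, hr⟩ := hs.exists
  refine ⟨r, hs.mono fun p hp => ?_⟩
  have hge : ∀ᶠ m in (hyperfilter ℕ : Filter ℕ), max p r ≤ m :=
    Nat.hyperfilter_le_atTop (eventually_ge_atTop _)
  obtain ⟨n, hpn, hrn, hn⟩ := ((hlim p).and ((hlim r).and hge)).exists
  filter_upwards [eventually_ge_atTop n] with m hm
  exact valueFrom_eq_of_le (le_of_max_le_left hn) (le_of_max_le_right hn)
    (by rw [hpn, hrn, hp, hr]) hm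

end ValueFrom

/-! ### Naming classes of positions -/

/-- Names for classes of positions; there is always a name not in use. -/
abbrev ClassName (S : Type) [Fintype S] : Type := Fin (Fintype.card S + 1)

section Names

variable {A S : Type} [Fintype S]

theorem exists_fresh_name (g : S → WithTop (ClassName S)) :
    ∃ i : ClassName S, ∀ s, g s ≠ i := by
  by_contra! h
  choose f hf using h
  have hinj : Function.Injective f := fun i j hij => by
    have := hf i
    rw [hij, hf j] at this
    exact (WithTop.coe_injective this).symm
  simpa using Fintype.card_le_of_injective f hinj

open Classical in
/-- Update of the assignment of names to values on reading `a`: merged classes take the least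
name, and the class of the new position takes a fresh name unless it is merged at once. -/
noncomputable def renameStep (step : S → A → S) (s₀ : S) (g : S → WithTop (ClassName S)) (a : A)
    (s : S) : WithTop (ClassName S) :=
  if s = step s₀ a ∧ ∀ t, step t a = s → g t = ⊤ then ((exists_fresh_name g).choose : ClassName S)
  else ({t | step t a = s} : Finset S).inf g

variable {step : S → A → S} {s₀ : S} {g : S → WithTop (ClassName S)} {a : A}

theorem renameStep_le (t : S) : renameStep step s₀ g a (step t a) ≤ g t := by
  unfold renameStep
  split_ifs with h
  · rw [h.2 t rfl]
    exact le_top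
  · exact Finset.inf_le (by simp)

theorem renameStep_new : renameStep step s₀ g a (step s₀ a) ≠ ⊤ := by
  by_cases h : ∀ t, step t a = step s₀ a → g t = ⊤
  · unfold renameStep
    rw [if_pos ⟨rfl, h⟩]
    exact WithTop.coe_ne_top
  · push Not at h
    obtain ⟨t, ht, hg⟩ := h
    exact ne_top_of_le_ne_top hg (ht ▸ renameStep_le t)

theorem renameStep_eq {s : S} (h : renameStep step s₀ g a s ≠ ⊤) :
    (s = step s₀ a ∧ ∀ t, g t ≠ renameStep step s₀ g a s) ∨
      ∃ t, step t a = s ∧ g t = renameStep step s₀ g a s := by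
  classical
  unfold renameStep at h ⊢
  split_ifs at h ⊢ with hs
  · exact Or.inl ⟨hs.1, (exists_fresh_name g).choose_spec⟩
  · right
    rcases Finset.eq_empty_or_nonempty ({t | step t a = s} : Finset S) with he | hne
    · simp [he] at h
    · obtain ⟨t, ht, hg⟩ := Finset.exists_mem_eq_inf _ hne g
      exact ⟨t, by simpa using ht, hg.symm⟩

theorem renameStep_injOn (hg : Set.InjOn g {s | g s ≠ ⊤}) :
    Set.InjOn (renameStep step s₀ g a) {s | renameStep step s₀ g a s ≠ ⊤} := by
  intro s hs t ht hst
  rcases renameStep_eq hs with ⟨hs', hs''⟩ | ⟨s', rfl, hs''⟩ <;>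
    rcases renameStep_eq ht with ⟨ht', ht''⟩ | ⟨t', rfl, ht''⟩
  · rw [hs', ht']
  · exact absurd (ht''.trans hst.symm) (hs'' t')
  · exact absurd (hs''.trans hst) (ht'' s')
  · have : s' = t' := hg (by rw [Set.mem_ofPred_eq, hs'']; exact hs)
      (by rw [Set.mem_ofPred_eq, ht'']; exact ht) (by rw [hs'', ht'', hst])
    rw [this]

end Names

/-! ### The merging automaton -/

/-- States of the merging automaton. -/
@[ext]
structure MergeState (S : Type) [Fintype S] where
  /-- The value of the prefix read so far. -/
  value : S
  /-- The name of the class of positions with a given value. -/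
  name : S → WithTop (ClassName S)
  /-- The pairs `(e, i)` such that some good position, at which the class `i` had value `e`, now
  has the given value. -/
  pending : S → Set (S × ClassName S)
  /-- The names which survived the last step. -/
  alive : Set (ClassName S)
  /-- The pairs `(i, e)` such that in the last step the class `i` absorbed a good position, at which
  the class `i` had value `e`. -/
  event : Set (ClassName S × S)

instance (S : Type) [Fintype S] : Finite (MergeState S) := by
  have : Finite (WithTop (ClassName S)) := inferInstanceAs (Finite (Option (ClassName S)))
  refine Finite.of_injective (fun x : MergeState S =>
    (x.value, x.name, x.pending, x.alive, x.event)) fun x y h => ?_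
  simp only [Prod.mk.injEq] at h
  exact MergeState.ext h.1 h.2.1 h.2.2.1 h.2.2.2.1 h.2.2.2.2

section Merge

variable {A S : Type} [Fintype S]

/-- Transitions of the merging automaton. -/
noncomputable def mergeStep (step : S → A → S) (s₀ : S) (good : S → S → Prop) (x : MergeState S)
    (a : A) : MergeState S where
  value := step x.value a
  name := renameStep step s₀ x.name a
  pending s := {c | (∃ t, step t a = s ∧ c ∈ x.pending t) ∨
    (s = step s₀ a ∧ x.name c.1 = c.2 ∧ good x.value c.1)}
  alive := {i | ∃ t, x.name t = i ∧ renameStep step s₀ x.name a (step t a) = i}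
  event := {c | (∃ t, (c.2, c.1) ∈ x.pending t ∧ x.name t ≠ c.1 ∧
      renameStep step s₀ x.name a (step t a) = c.1) ∨
    (x.name c.2 = c.1 ∧ good x.value c.2 ∧ renameStep step s₀ x.name a (step s₀ a) = c.1)}

/-- The deterministic Rabin automaton accepting the words in which some class of merging positions
absorbs infinitely many good positions of the same value. -/
noncomputable def mergeDRA (step : S → A → S) (s₀ : S) (good : S → S → Prop) : DRA A :=
  letI := Fintype.ofFinite (MergeState S)
  { Q := MergeState S
    δ := mergeStep step s₀ good
    qI := ⟨s₀, fun _ => ⊤, fun _ => ∅, ∅, ∅⟩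
    R := Finset.univ.image fun c : ClassName S × S => ({x | c.1 ∉ x.alive}, {x | c ∈ x.event}) }

variable (step : S → A → S) (s₀ : S) (good : S → S → Prop) (w : ℕ → A)

/-- The run of the merging automaton. -/
noncomputable def mergeRun (n : ℕ) : MergeState S := (mergeDRA step s₀ good).run w n

/-- The name at time `n` of the class of the position `p`. -/
noncomputable def nameAt (p n : ℕ) : WithTop (ClassName S) :=
  (mergeRun step s₀ good w n).name (valueFrom step s₀ w p n)

theorem mergeRun_succ (n : ℕ) :
    mergeRun step s₀ good w (n + 1) = mergeStep step s₀ good (mergeRun step s₀ good w n) (w n) :=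
  rfl

theorem mergeDRA_accepts_iff :
    (mergeDRA step s₀ good).Accepts w ↔ ∃ i e,
      (∃ᶠ n in atTop, (i, e) ∈ (mergeRun step s₀ good w n).event) ∧
        ∀ᶠ n in atTop, i ∈ (mergeRun step s₀ good w n).alive := by
  constructor
  · rintro ⟨_, hc, hev, hal⟩
    obtain ⟨⟨i, e⟩, -, rfl⟩ := Finset.mem_image.1 hc
    exact ⟨i, e, hev, hal.mono fun _ h => not_not.1 h⟩
  · rintro ⟨i, e, hev, hal⟩
    exact ⟨_, Finset.mem_image_of_mem _ (Finset.mem_univ (i, e)), hev,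
      hal.mono fun _ h => not_not.2 h⟩

theorem mergeRun_value (n : ℕ) :
    (mergeRun step s₀ good w n).value = valueFrom step s₀ w 0 n := by
  induction n with
  | zero => rfl
  | succ n ih => rw [valueFrom_succ n.zero_le, ← ih]; rfl

theorem mergeRun_name_injOn (n : ℕ) : Set.InjOn (mergeRun step s₀ good w n).name
    {s | (mergeRun step s₀ good w n).name s ≠ ⊤} := by
  induction n with
  | zero => exact fun s hs => absurd rfl hs
  | succ n ih => exact renameStep_injOn ih

variable {step s₀ good w}

theorem exists_nameAt_eq {n : ℕ} {s : S} (h : (mergeRun step s₀ good w n).name s ≠ ⊤) :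
    ∃ p < n, valueFrom step s₀ w p n = s := by
  induction n generalizing s with
  | zero => exact absurd rfl h
  | succ n ih =>
    rcases renameStep_eq h with ⟨rfl, -⟩ | ⟨t, rfl, ht⟩
    · exact ⟨n, n.lt_succ_self, valueFrom_self_succ n⟩
    · obtain ⟨p, hp, rfl⟩ := ih (s := t) (fun htop => h (ht.symm.trans htop))
      exact ⟨p, hp.trans n.lt_succ_self, valueFrom_succ hp.le⟩

theorem nameAt_self_succ_ne_top (p : ℕ) : nameAt step s₀ good w p (p + 1) ≠ ⊤ := by
  rw [nameAt, valueFrom_self_succ]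
  exact renameStep_new

theorem nameAt_succ_le {p n : ℕ} (h : p ≤ n) :
    nameAt step s₀ good w p (n + 1) ≤ nameAt step s₀ good w p n := by
  rw [nameAt, valueFrom_succ h]
  exact renameStep_le _

theorem nameAt_antitone {p n m : ℕ} (h : p ≤ n) (hnm : n ≤ m) :
    nameAt step s₀ good w p m ≤ nameAt step s₀ good w p n := by
  induction m, hnm using Nat.le_induction with
  | base => exact le_rfl
  | succ m hm ih => exact (nameAt_succ_le (h.trans hm)).trans ih

theorem exists_eventually_nameAt_eq (p : ℕ) :
    ∃ i : ClassName S, ∀ᶠ n in atTop, nameAt step s₀ good w p n = i := by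
  obtain ⟨m, ⟨n, hn, rfl⟩, hmin⟩ := (wellFounded_lt (α := WithTop (ClassName S))).has_min
    (nameAt step s₀ good w p '' {n | p < n}) ⟨_, p + 1, p.lt_succ_self, rfl⟩
  have hle : ∀ {m}, n ≤ m → nameAt step s₀ good w p m = nameAt step s₀ good w p n :=
    fun {m} hm => (nameAt_antitone (le_of_lt hn) hm).eq_of_not_lt
      (hmin _ ⟨m, lt_of_lt_of_le hn hm, rfl⟩)
  have htop : nameAt step s₀ good w p n ≠ ⊤ :=
    ne_top_of_le_ne_top (nameAt_self_succ_ne_top p) (nameAt_antitone p.le_succ hn)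
  obtain ⟨i, hi⟩ := WithTop.ne_top_iff_exists.1 htop
  exact ⟨i, (eventually_ge_atTop n).mono fun m hm => (hle hm).trans hi.symm⟩

theorem valueFrom_eq_of_name_eq {p n : ℕ} {s : S} {i : ClassName S}
    (hp : nameAt step s₀ good w p n = i) (hs : (mergeRun step s₀ good w n).name s = i) :
    valueFrom step s₀ w p n = s :=
  mergeRun_name_injOn step s₀ good w n (by
    rw [Set.mem_ofPred_eq]; unfold nameAt at hp; rw [hp]; exact WithTop.coe_ne_top)
    (by rw [Set.mem_ofPred_eq, hs]; exact WithTop.coe_ne_top) (hp.trans hs.symm)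

variable (step s₀ good w) in
/-- At time `p`, the class named `i` has value `e`, and `e` is good for the prefix. -/
def IsRecorded (i : ClassName S) (e : S) (p : ℕ) : Prop :=
  (mergeRun step s₀ good w p).name e = i ∧ good (valueFrom step s₀ w 0 p) e

theorem mem_pending_iff {n : ℕ} {s e : S} {i : ClassName S} :
    (e, i) ∈ (mergeRun step s₀ good w n).pending s ↔
      ∃ p < n, valueFrom step s₀ w p n = s ∧ IsRecorded step s₀ good w i e p := by
  induction n generalizing s with
  | zero => exact ⟨fun h => h.elim, fun ⟨p, hp, _⟩ => absurd hp p.not_lt_zero⟩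
  | succ n ih =>
    simp only [mergeRun_succ, mergeStep, Set.mem_ofPred_eq, ih, mergeRun_value]
    constructor
    · rintro (⟨t, rfl, p, hp, rfl, hr⟩ | ⟨rfl, hr⟩)
      · exact ⟨p, hp.trans n.lt_succ_self, valueFrom_succ hp.le, hr⟩
      · exact ⟨n, n.lt_succ_self, valueFrom_self_succ n, hr⟩
    · rintro ⟨p, hp, rfl, hr⟩
      rcases Nat.lt_succ_iff_lt_or_eq.1 hp with hp | rfl
      · exact Or.inl ⟨_, (valueFrom_succ hp.le).symm, p, hp, rfl, hr⟩
      · exact Or.inr ⟨valueFrom_self_succ p, hr⟩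

variable (step s₀ good w) in
/-- The position `p` enters the class named `i` in the step from time `n` to time `n + 1`. -/
def Enters (i : ClassName S) (p n : ℕ) : Prop :=
  nameAt step s₀ good w p (n + 1) = i ∧ (p < n ∧ nameAt step s₀ good w p n ≠ i ∨ p = n)

theorem mem_event_succ_iff {n : ℕ} {e : S} {i : ClassName S} :
    (i, e) ∈ (mergeRun step s₀ good w (n + 1)).event ↔
      ∃ p, IsRecorded step s₀ good w i e p ∧ Enters step s₀ good w i p n := by
  simp only [mergeRun_succ, mergeStep, Set.mem_ofPred_eq, mem_pending_iff, mergeRun_value]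
  constructor
  · rintro (⟨t, ⟨p, hp, rfl, hr⟩, hne, heq⟩ | ⟨hn, hg, heq⟩)
    · refine ⟨p, hr, ?_, Or.inl ⟨hp, hne⟩⟩
      rw [nameAt, valueFrom_succ hp.le]
      exact heq
    · refine ⟨n, ⟨hn, hg⟩, ?_, Or.inr rfl⟩
      rw [nameAt, valueFrom_self_succ]
      exact heq
  · rintro ⟨p, hr, heq, ⟨hp, hne⟩ | rfl⟩
    · rw [nameAt, valueFrom_succ hp.le] at heq
      exact Or.inl ⟨_, ⟨p, hp, rfl, hr⟩, hne, heq⟩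
    · rw [nameAt, valueFrom_self_succ] at heq
      exact Or.inr ⟨hr.1, hr.2, heq⟩

theorem nameAt_succ_of_alive {p n : ℕ} {i : ClassName S} (hp : p ≤ n)
    (ha : i ∈ (mergeRun step s₀ good w (n + 1)).alive)
    (h : nameAt step s₀ good w p n = i) : nameAt step s₀ good w p (n + 1) = i := by
  obtain ⟨t, ht, ht'⟩ := ha
  rw [nameAt, valueFrom_succ hp, valueFrom_eq_of_name_eq h ht]
  exact ht'

theorem nameAt_of_alive {p n m N : ℕ} {i : ClassName S}
    (ha : ∀ m ≥ N, i ∈ (mergeRun step s₀ good w m).alive) (hp : p ≤ n) (hN : N ≤ n)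
    (h : nameAt step s₀ good w p n = i) (hnm : n ≤ m) : nameAt step s₀ good w p m = i := by
  induction m, hnm using Nat.le_induction with
  | base => exact h
  | succ m hm ih => exact nameAt_succ_of_alive (hp.trans hm) (ha _ (by omega)) ih

theorem exists_enters {p n : ℕ} {i : ClassName S} (hp : p < n)
    (h : nameAt step s₀ good w p n = i) : ∃ m ≥ p, Enters step s₀ good w i p m := by
  induction n, hp using Nat.le_induction with
  | base => exact ⟨p, le_rfl, h, Or.inr rfl⟩
  | succ n hn ih =>
    by_cases hi : nameAt step s₀ good w p n = i
    · exact ih hi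
    · exact ⟨n, (Nat.lt_of_succ_le hn).le, h, Or.inl ⟨hn, hi⟩⟩

theorem mergeDRA_accepts_of_mergesInto {r : ℕ} {e : S}
    (h : ∃ᶠ p in atTop, MergesInto step s₀ w r e p ∧ good (valueFrom step s₀ w 0 p) e) :
    (mergeDRA step s₀ good).Accepts w := by
  obtain ⟨i, hi⟩ := exists_eventually_nameAt_eq (step := step) (s₀ := s₀) (good := good) (w := w) r
  obtain ⟨N, hN⟩ := eventually_atTop.1 hi
  refine (mergeDRA_accepts_iff step s₀ good w).2 ⟨i, e, frequently_atTop.2 fun M => ?_, ?_⟩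
  · obtain ⟨p, ⟨⟨hrp, hv, hmerge⟩, hgood⟩, hp⟩ :=
      (h.and_eventually (eventually_ge_atTop (max M N))).exists
    obtain ⟨n, hn, hpn, hnN⟩ :=
      (hmerge.and ((eventually_gt_atTop p).and (eventually_ge_atTop N))).exists
    obtain ⟨m, hm, hent⟩ := exists_enters (step := step) (s₀ := s₀) (good := good) (w := w)
      (i := i) hpn (by rw [nameAt, hn]; exact hN n hnN)
    refine ⟨m + 1, by omega, mem_event_succ_iff.2 ⟨p, ⟨?_, hgood⟩, hent⟩⟩
    rw [← hv]
    exact hN p (by omega)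
  · filter_upwards [eventually_gt_atTop (max N r)] with n hn
    obtain ⟨n, rfl⟩ : ∃ k, n = k + 1 := ⟨n - 1, by omega⟩
    refine ⟨_, hN n (by omega), ?_⟩
    have := hN (n + 1) (by omega)
    rwa [nameAt, valueFrom_succ (by omega)] at this

theorem exists_mergesInto_of_mergeDRA_accepts (h : (mergeDRA step s₀ good).Accepts w) :
    ∃ r e, ∃ᶠ p in atTop, MergesInto step s₀ w r e p ∧ good (valueFrom step s₀ w 0 p) e := by
  obtain ⟨i, e, hev, hal⟩ := (mergeDRA_accepts_iff step s₀ good w).1 h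
  obtain ⟨N, hN⟩ := eventually_atTop.1 hal
  obtain ⟨t, ht, -⟩ := hN (N + 1) N.le_succ
  obtain ⟨r, hr, rfl⟩ := exists_nameAt_eq (step := step) (s₀ := s₀) (good := good) (w := w)
    (n := N) (s := t) (fun htop => WithTop.coe_ne_top (ht.symm.trans htop))
  have hname : ∀ n ≥ N, nameAt step s₀ good w r n = i :=
    fun n hn => nameAt_of_alive hN hr.le le_rfl ht hn
  refine ⟨r, e, frequently_atTop.2 fun M => ?_⟩
  have hent : ∃ᶠ n in atTop,
      ∃ p, IsRecorded step s₀ good w i e p ∧ Enters step s₀ good w i p n := by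
    refine frequently_atTop.2 fun m => ?_
    obtain ⟨n, hn, hmem⟩ := frequently_atTop.1 hev (m + 1)
    obtain ⟨n, rfl⟩ : ∃ k, n = k + 1 := ⟨n - 1, by omega⟩
    exact ⟨n, by omega, mem_event_succ_iff.1 hmem⟩
  obtain ⟨n, ⟨p, hrec, hen⟩, hn, hlate⟩ : ∃ n,
      (∃ p, IsRecorded step s₀ good w i e p ∧ Enters step s₀ good w i p n) ∧ N ≤ n ∧
        ∀ p < max M (N + 1), ¬ Enters step s₀ good w i p n := by
    have hfin : ∀ p, ∀ᶠ n in atTop, ¬ Enters step s₀ good w i p n := by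
      intro p
      by_contra hp
      rw [← Filter.Frequently] at hp
      obtain ⟨n, hnp, hn, -⟩ := frequently_atTop.1 hp (max N p)
      obtain ⟨m, hm, -, hm'⟩ := frequently_atTop.1 hp (n + 1)
      rcases hm' with ⟨hpm, hne⟩ | rfl
      · exact hne (nameAt_of_alive hN (by omega) (by omega) hn hm)
      · omega
    exact (hent.and_eventually ((eventually_ge_atTop N).and
      ((Set.finite_Iio (max M (N + 1))).eventually_all.2 fun p _ => hfin p))).exists
  have hp : max M (N + 1) ≤ p := not_lt.1 fun hlt => hlate p hlt hen
  have hpn : p ≤ n := by rcases hen.2 with h | h <;> omega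
  refine ⟨p, by omega, ⟨by omega, valueFrom_eq_of_name_eq (hname p (by omega)) hrec.1, ?_⟩,
    hrec.2⟩
  filter_upwards [eventually_ge_atTop (n + 1)] with m hm
  exact valueFrom_eq_of_name_eq (nameAt_of_alive hN (by omega) (by omega) hen.1 hm)
    (hname m (by omega))

variable (step s₀ good w) in
theorem mergeDRA_accepts_iff_exists_mergesInto : (mergeDRA step s₀ good).Accepts w ↔
    ∃ r e, ∃ᶠ p in atTop, MergesInto step s₀ w r e p ∧ good (valueFrom step s₀ w 0 p) e :=
  ⟨exists_mergesInto_of_mergeDRA_accepts, fun ⟨_, _, h⟩ => mergeDRA_accepts_of_mergesInto h⟩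

end Merge

/-! ### Transition profiles of a Büchi automaton -/

namespace NBA

variable {A : Type} (B : NBA A)

/-- A transition profile: triples of a source, whether an accepting state is visited after the
source, and a target. -/
abbrev Profile : Type := Set (B.Q × Prop × B.Q)

/-- Extension of a profile by a letter. -/
def profileStep (s : B.Profile) (a : A) : B.Profile :=
  {c | ∃ q b, (c.1, b, q) ∈ s ∧ c.2.2 ∈ B.Δ q a ∧ c.2.1 = (b ∨ c.2.2 ∈ B.F)}

/-- The profile of the empty word. -/
def profileNil : B.Profile := {c | c.1 = c.2.2 ∧ c.2.1 = False}

/-- The profile of the infix of `w` from `p` to `n`. -/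
abbrev profile (w : ℕ → A) : ℕ → ℕ → B.Profile := valueFrom B.profileStep B.profileNil w

/-- Some sequence of states starting in a target of `s` follows the profile `e` forever and visits
accepting states infinitely often. -/
def GoodProfile (s e : B.Profile) : Prop :=
  ∃ (c : ℕ → B.Q) (b : ℕ → Prop), (∃ b₀, (B.qI, b₀, c 0) ∈ s) ∧
    (∀ k, (c k, b k, c (k + 1)) ∈ e) ∧ ∃ᶠ k in atTop, b k

variable {B} {w : ℕ → A}

theorem mem_profile_of_path {ρ : ℕ → B.Q} {p n : ℕ} (hpn : p ≤ n)
    (h : ∀ i, p ≤ i → i < n → ρ (i + 1) ∈ B.Δ (ρ i) (w i)) :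
    (ρ p, (∃ i, p < i ∧ i ≤ n ∧ ρ i ∈ B.F), ρ n) ∈ B.profile w p n := by
  induction n, hpn using Nat.le_induction with
  | base =>
    rw [profile, valueFrom_of_le le_rfl]
    refine ⟨rfl, eq_false ?_⟩
    rintro ⟨i, h₁, h₂, -⟩
    omega
  | succ n hn ih =>
    rw [profile, valueFrom_succ hn]
    refine ⟨_, _, ih fun i hi hi' => h i hi (by omega), h n hn n.lt_succ_self, propext ⟨?_, ?_⟩⟩
    · rintro ⟨i, hi, hi', hF⟩
      rcases Nat.le_succ_iff.1 hi' with hi' | rfl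
      · exact Or.inl ⟨i, hi, hi', hF⟩
      · exact Or.inr hF
    · rintro (⟨i, hi, hi', hF⟩ | hF)
      · exact ⟨i, hi, by omega, hF⟩
      · exact ⟨n + 1, by omega, le_rfl, hF⟩

theorem exists_path_of_mem_profile {p n : ℕ} (hpn : p ≤ n) {q q' : B.Q} {b : Prop}
    (h : (q, b, q') ∈ B.profile w p n) :
    ∃ ρ : ℕ → B.Q, ρ p = q ∧ ρ n = q' ∧
      (∀ i, p ≤ i → i < n → ρ (i + 1) ∈ B.Δ (ρ i) (w i)) ∧
        (b → ∃ i, p < i ∧ i ≤ n ∧ ρ i ∈ B.F) := by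
  induction n, hpn using Nat.le_induction generalizing q' b with
  | base =>
    rw [profile, valueFrom_of_le le_rfl] at h
    obtain ⟨h₁, h₂⟩ := h
    exact ⟨fun _ => q, rfl, h₁, fun i _ _ => by omega, fun hb => (h₂.mp hb).elim⟩
  | succ n hn ih =>
    rw [profile, valueFrom_succ hn] at h
    obtain ⟨q₁, b₁, hmem, hΔ, hb⟩ := h
    obtain ⟨ρ, hp, hn', hstep, hF⟩ := ih hmem
    have hold : ∀ i ≤ n, Function.update ρ (n + 1) q' i = ρ i :=
      fun i hi => Function.update_of_ne (by omega) _ _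
    refine ⟨Function.update ρ (n + 1) q', by rw [hold p hn, hp], Function.update_self .., ?_, ?_⟩
    · intro i hi hi'
      rcases Nat.lt_succ_iff_lt_or_eq.1 hi' with hlt | rfl
      · rw [hold i hlt.le, hold (i + 1) hlt]
        exact hstep i hi hlt
      · rw [hold i le_rfl, Function.update_self, hn']
        exact hΔ
    · intro hb'
      rcases (show b₁ ∨ q' ∈ B.F from hb ▸ hb') with h₁ | h₁
      · obtain ⟨i, hi, hi', hiF⟩ := hF h₁
        exact ⟨i, hi, by omega, by rwa [hold i hi']⟩
      · exact ⟨n + 1, by omega, le_rfl, by rwa [Function.update_self]⟩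

theorem exists_run_of_chain {p : ℕ → ℕ} (hp : StrictMono p) (hp0 : p 0 = 0) {c : ℕ → B.Q}
    {b : ℕ → Prop} (h : ∀ k, (c k, b k, c (k + 1)) ∈ B.profile w (p k) (p (k + 1))) :
    ∃ ρ : ℕ → B.Q, ρ 0 = c 0 ∧ (∀ i, ρ (i + 1) ∈ B.Δ (ρ i) (w i)) ∧
      ∀ k, b k → ∃ i > p k, ρ i ∈ B.F := by
  choose σ hσ hσ' hstep hF using fun k =>
    exists_path_of_mem_profile (hp.monotone k.le_succ) (h k)
  let κ : ℕ → ℕ := fun n => Nat.findGreatest (fun k => p k ≤ n) n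
  have hκ : ∀ n, p (κ n) ≤ n := fun n =>
    Nat.findGreatest_spec (P := fun k => p k ≤ n) n.zero_le (by simp [hp0])
  have hκ' : ∀ n, n < p (κ n + 1) := by
    intro n
    by_contra! hle
    exact absurd (Nat.le_findGreatest (P := fun k => p k ≤ n) ((hp.id_le _).trans hle) hle)
      (Nat.not_succ_le_self _)
  have hκ_eq : ∀ {n k}, p k ≤ n → n < p (k + 1) → κ n = k := by
    intro n k h₁ h₂
    have h₃ := hp.lt_iff_lt.1 ((hκ n).trans_lt h₂)
    have h₄ := hp.lt_iff_lt.1 (h₁.trans_lt (hκ' n))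
    omega
  have hseg : ∀ {n k}, p k ≤ n → n ≤ p (k + 1) → σ (κ n) n = σ k n := by
    intro n k h₁ h₂
    rcases h₂.lt_or_eq with h₂ | rfl
    · rw [hκ_eq h₁ h₂]
    · rw [hκ_eq le_rfl (hp (Nat.lt_succ_self _)), hσ, hσ']
  refine ⟨fun n => σ (κ n) n, ?_, fun i => ?_, fun k hk => ?_⟩
  · have : κ 0 = 0 := by simp [κ]
    beta_reduce
    rw [this, ← hσ 0, hp0]
  · have := hstep (κ i) i (hκ i) (hκ' i)
    beta_reduce
    rwa [hseg (k := κ i) ((hκ i).trans i.le_succ) (hκ' i)]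
  · obtain ⟨i, hi, hi', hiF⟩ := hF k hk
    exact ⟨i, hi, by beta_reduce; rwa [hseg hi.le hi']⟩

theorem Accepts.exists_mergesInto (h : B.Accepts w) :
    ∃ r e, ∃ᶠ p in atTop, MergesInto B.profileStep B.profileNil w r e p ∧
      B.GoodProfile (B.profile w 0 p) e := by
  obtain ⟨ρ, ⟨hρ0, hρ⟩, hF⟩ := h
  obtain ⟨r, hr⟩ := exists_frequently_eventually_eq B.profileStep B.profileNil w
  obtain ⟨e, he⟩ : ∃ e, ∃ᶠ p in atTop, MergesInto B.profileStep B.profileNil w r e p := by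
    refine frequently_exists.1 ((hr.and_eventually (eventually_gt_atTop r)).mono ?_)
    exact fun p hp => ⟨_, hp.2, rfl, hp.1⟩
  refine ⟨r, e, he.mono fun p₀ hp₀ => ⟨hp₀, ?_⟩⟩
  obtain ⟨p, rfl, hp, hpe⟩ := MergesInto.exists_chain he hp₀
  refine ⟨fun k => ρ (p k), fun k => ∃ i, p k < i ∧ i ≤ p (k + 1) ∧ ρ i ∈ B.F, ?_, ?_, ?_⟩
  · have := mem_profile_of_path (w := w) (Nat.zero_le (p 0)) fun i _ _ => hρ i
    rw [hρ0] at this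
    exact ⟨_, this⟩
  · intro k
    rw [← hpe k]
    exact mem_profile_of_path (hp.monotone k.le_succ) fun i _ _ => hρ i
  · refine frequently_atTop.2 fun K => ?_
    obtain ⟨i, hi, hiF⟩ := frequently_atTop.1 hF (p K + 1)
    have hex : ∃ k, i ≤ p (k + 1) := ⟨i, i.le_succ.trans (hp.id_le _)⟩
    have hK : K ≤ Nat.find hex := (Nat.le_find_iff _ _).2 fun m hm hle => by
      have := hp.monotone (Nat.succ_le_of_lt hm)
      simp only [Nat.succ_eq_add_one] at this
      omega
    refine ⟨Nat.find hex, hK, i, ?_, Nat.find_spec hex, hiF⟩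
    rcases Nat.eq_zero_or_pos (Nat.find hex) with h0 | hpos
    · rw [h0] at hK ⊢
      rw [Nat.le_zero.1 hK] at hi
      omega
    · have := Nat.find_min hex (Nat.sub_one_lt_of_lt hpos)
      rw [Nat.sub_one_add_one hpos.ne'] at this
      omega

theorem accepts_of_mergesInto {r : ℕ} {e : B.Profile}
    (h : ∃ᶠ p in atTop, MergesInto B.profileStep B.profileNil w r e p ∧
      B.GoodProfile (B.profile w 0 p) e) : B.Accepts w := by
  obtain ⟨p₀, hp₀, c, b, ⟨b₀, hb₀⟩, hc, hb⟩ := h.exists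
  obtain ⟨p, hp0, hp, hpe⟩ := MergesInto.exists_chain (h.mono fun _ => And.left) hp₀
  let p' : ℕ → ℕ := fun k => k.casesOn 0 p
  let c' : ℕ → B.Q := fun k => k.casesOn B.qI c
  let b' : ℕ → Prop := fun k => k.casesOn b₀ b
  have hp' : StrictMono p' := strictMono_nat_of_lt_succ fun k => by
    cases k with
    | zero =>
      change 0 < p 0
      rw [hp0]
      exact (Nat.zero_le r).trans_lt hp₀.1
    | succ k => exact hp k.lt_succ_self
  obtain ⟨ρ, hρ0, hρ, hF⟩ := exists_run_of_chain (w := w) hp' rfl (c := c') (b := b') fun k => by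
    cases k with
    | zero =>
      change (B.qI, b₀, c 0) ∈ B.profile w 0 (p 0)
      rwa [hp0]
    | succ k =>
      change (c k, b k, c (k + 1)) ∈ B.profile w (p k) (p (k + 1))
      rw [profile, hpe k]
      exact hc k
  refine ⟨ρ, ⟨hρ0, hρ⟩, frequently_atTop.2 fun K => ?_⟩
  obtain ⟨k, hk, hbk⟩ := frequently_atTop.1 hb K
  obtain ⟨i, hi, hiF⟩ := hF (k + 1) hbk
  have := hp.id_le k
  exact ⟨i, hk.trans (this.trans (le_of_lt hi)), hiF⟩

end NBA

/-- Every nondeterministic Büchi automaton is equivalent to a deterministic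
Rabin automaton. -/
theorem nba_to_dra (A : Type) [Fintype A] [Nonempty A] (B : NBA A) :
    ∃ D : DRA A, ∀ w : ℕ → A, B.Accepts w ↔ D.Accepts w := by
  classical
  let := Fintype.ofFinite B.Profile
  refine ⟨mergeDRA B.profileStep B.profileNil B.GoodProfile, fun w => ?_⟩
  rw [mergeDRA_accepts_iff_exists_mergesInto]
  exact ⟨NBA.Accepts.exists_mergesInto, fun ⟨_, _, h⟩ => NBA.accepts_of_mergesInto h⟩
end

section
/- For every nondeterministic Büchi automaton B over a finite alphabet Σ with n ≥ 1 states there exists a deterministic Rabin automaton over Σ recognizing the same ω-language whose state set has cardinality at most 6^(2n−1)·(n+1)^(n+1) and whose Rabin acceptance condition consists of at most 2^(n+1) Rabin pairs. -/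
open Filter

namespace HistoryTree

/-- The `i`-th entry of a path, with `⊤` beyond its end. -/
def label (x : List ℕ) (i : ℕ) : ℕ∞ := if h : i < x.length then ((x[i] : ℕ) : ℕ∞) else ⊤

/-- The sort key of a path: lexicographic comparison of keys puts older siblings first, and
descendants before their ancestors. -/
def key (x : List ℕ) : Lex (ℕ → ℕ∞) := toLex (label x)

/-- The paths `x` and `y` coincide on their first `k` entries. -/
def Agree (k : ℕ) (x y : List ℕ) : Prop := ∀ i < k, label x i = label y i

lemma label_eq_top {x : List ℕ} {i : ℕ} : label x i = ⊤ ↔ x.length ≤ i := by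
  unfold label; split_ifs with h <;> simp [h]; omega

lemma label_lt_top {x : List ℕ} {i : ℕ} : label x i < ⊤ ↔ i < x.length := by
  rw [lt_top_iff_ne_top, Ne, label_eq_top, not_le]

lemma label_take (x : List ℕ) (k i : ℕ) :
    label (x.take k) i = if i < k then label x i else ⊤ := by
  unfold label
  by_cases h1 : i < k <;> by_cases h2 : i < x.length <;> simp [h1, h2]

lemma label_append (x : List ℕ) (t i : ℕ) :
    label (x ++ [t]) i = if i = x.length then (t : ℕ∞) else label x i := by
  unfold label
  by_cases h1 : i = x.length
  · simp [h1]
  · by_cases h2 : i < x.length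
    · have : i < x.length + 1 := by omega
      simp [h1, h2, this, List.getElem_append_left]
    · have : ¬ i < x.length + 1 := by omega
      simp [h1, h2, this]

lemma label_lt {x : List ℕ} {t i : ℕ} (hx : ∀ a ∈ x, a < t) (hi : i < x.length) :
    label x i < t := by
  simp only [label, hi, dif_pos]
  exact_mod_cast hx _ (List.getElem_mem hi)

lemma label_ne {x : List ℕ} {t : ℕ} (hx : ∀ a ∈ x, a < t) (i : ℕ) : label x i ≠ t := by
  rcases lt_or_ge i x.length with h | h
  · exact (label_lt hx h).ne
  · rw [label_eq_top.2 h]; exact ENat.top_ne_natCast t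

lemma label_injective {x y : List ℕ} (h : ∀ i, label x i = label y i) : x = y := by
  have hl : x.length = y.length := by
    apply le_antisymm
    · rw [← label_eq_top, h, label_eq_top]
    · rw [← label_eq_top, ← h, label_eq_top]
  refine List.ext_getElem hl fun i h1 h2 => ?_
  have := h i
  simp only [label, h1, h2, dif_pos] at this
  exact_mod_cast this

lemma key_lt {x y : List ℕ} : key x < key y ↔ ∃ i, Agree i x y ∧ label x i < label y i := Iff.rfl

lemma key_injective {x y : List ℕ} (h : key x = key y) : x = y :=
  label_injective fun i => congrFun h i

lemma Agree.symm {k : ℕ} {x y : List ℕ} (h : Agree k x y) : Agree k y x :=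
  fun i hi => (h i hi).symm

lemma agree_comm {k : ℕ} {x y : List ℕ} : Agree k x y ↔ Agree k y x := ⟨.symm, .symm⟩

lemma Agree.trans {k : ℕ} {x y z : List ℕ} (h : Agree k x y) (h' : Agree k y z) : Agree k x z :=
  fun i hi => (h i hi).trans (h' i hi)

lemma Agree.mono {k l : ℕ} {x y : List ℕ} (h : Agree k x y) (hl : l ≤ k) : Agree l x y :=
  fun i hi => h i (hi.trans_le hl)

lemma Agree.refl (k : ℕ) (x : List ℕ) : Agree k x x := fun _ _ => rfl

lemma agree_take_left {k : ℕ} {x : List ℕ} : Agree k (x.take k) x := fun i hi => by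
  rw [label_take, if_pos hi]

lemma Agree.eq {x y : List ℕ} (hl : x.length = y.length) (h : Agree x.length x y) : x = y := by
  refine label_injective fun i => ?_
  rcases lt_or_ge i x.length with hi | hi
  · exact h i hi
  · rw [label_eq_top.2 hi, label_eq_top.2 (hl ▸ hi)]

lemma Agree.length_le {k : ℕ} {x y : List ℕ} (h : Agree k x y) (hk : k ≤ x.length) :
    k ≤ y.length := by
  by_contra! hy
  have := h _ hy
  rw [label_eq_top.2 le_rfl, label_eq_top] at this
  omega

lemma eq_take_iff {k : ℕ} {x y : List ℕ} (hk : k ≤ y.length) :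
    x = y.take k ↔ x.length = k ∧ Agree k x y := by
  constructor
  · rintro rfl
    exact ⟨by simp [hk], agree_take_left⟩
  · rintro ⟨rfl, h⟩
    exact Agree.eq (by simp [hk]) (h.trans agree_take_left.symm)

lemma exists_first_difference {k : ℕ} {x y : List ℕ} (h : ¬ Agree k x y) :
    ∃ i < k, Agree i x y ∧ label x i ≠ label y i := by
  classical
  have h' : ∃ i, i < k ∧ label x i ≠ label y i := by simpa [Agree] using h
  refine ⟨Nat.find h', (Nat.find_spec h').1, fun i hi => ?_, (Nat.find_spec h').2⟩
  have := Nat.find_min h' hi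
  have hk := (Nat.find_spec h').1
  by_contra hne
  exact this ⟨by omega, hne⟩

lemma agree_append_append {k t : ℕ} {x y : List ℕ} (hx : ∀ a ∈ x, a < t) (hy : ∀ a ∈ y, a < t) :
    Agree k (x ++ [t]) (y ++ [t]) ↔ Agree k x y := by
  constructor
  · intro h
    by_contra hn
    obtain ⟨i, hi, ha, hne⟩ := exists_first_difference hn
    have := h i hi
    rw [label_append, label_append] at this
    have h1 := label_ne hx i
    have h2 := label_ne hy i
    split_ifs at this with e1 e2 e2
    · exact hne (by rw [label_eq_top.2 e1.ge, label_eq_top.2 e2.ge])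
    · exact h2 this.symm
    · exact h1 this
    · exact hne this
  · intro h i hi
    rw [label_append, label_append]
    have h0 := h i hi
    split_ifs with e1 e2 e2
    · rfl
    · rw [label_eq_top.2 e1.ge] at h0
      have := label_eq_top.1 h0.symm
      have := h.mono (l := y.length + 1) (by omega) y.length (by omega)
      rw [label_eq_top.2 le_rfl, label_eq_top] at this
      omega
    · rw [label_eq_top.2 e2.ge] at h0
      have := label_eq_top.1 h0
      have := h.mono (l := x.length + 1) (by omega) x.length (by omega)
      rw [label_eq_top.2 le_rfl, eq_comm, label_eq_top] at this
      omega
    · exact h0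

lemma agree_append_left {k t : ℕ} {x y : List ℕ} (hy : ∀ a ∈ y, a < t) :
    Agree k (x ++ [t]) y ↔ Agree k x y ∧ k ≤ x.length := by
  constructor
  · intro h
    have hk : k ≤ x.length := by
      by_contra! hk
      have := h _ hk
      rw [label_append, if_pos rfl] at this
      exact label_ne hy _ this.symm
    refine ⟨fun i hi => ?_, hk⟩
    have := h i hi
    rwa [label_append, if_neg (by omega)] at this
  · rintro ⟨h, hk⟩ i hi
    rw [label_append, if_neg (by omega), h i hi]

lemma key_append_lt_append {t : ℕ} {x y : List ℕ} (hx : ∀ a ∈ x, a < t) (hy : ∀ a ∈ y, a < t)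
    (h : key x < key y) : key (x ++ [t]) < key (y ++ [t]) := by
  obtain ⟨i, ha, hi⟩ := key_lt.1 h
  refine key_lt.2 ⟨i, (agree_append_append hx hy).2 ha, ?_⟩
  have hix : i < x.length := label_lt_top.1 (hi.trans_le le_top)
  rw [label_append, label_append, if_neg hix.ne]
  split_ifs
  · exact label_lt hx hix
  · exact hi

lemma key_append_lt_append_iff {t : ℕ} {x y : List ℕ} (hx : ∀ a ∈ x, a < t)
    (hy : ∀ a ∈ y, a < t) : key (x ++ [t]) < key (y ++ [t]) ↔ key x < key y := by
  refine ⟨fun h => ?_, key_append_lt_append hx hy⟩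
  rcases lt_trichotomy (key x) (key y) with h' | h' | h'
  · exact h'
  · rw [key_injective h'] at h; exact (lt_irrefl _ h).elim
  · exact (lt_asymm h (key_append_lt_append hy hx h')).elim

lemma key_append_lt_self {t : ℕ} (x : List ℕ) : key (x ++ [t]) < key x := by
  refine key_lt.2 ⟨x.length, fun i hi => ?_, ?_⟩
  · rw [label_append, if_neg hi.ne]
  · rw [label_append, if_pos rfl, label_eq_top.2 le_rfl]; exact ENat.natCast_lt_top t

lemma lt_key_append_iff {t : ℕ} {x y : List ℕ} (hy : ∀ a ∈ y, a < t) :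
    key y < key (x ++ [t]) ↔ key y < key x := by
  refine ⟨fun h => h.trans (key_append_lt_self x), fun h => ?_⟩
  obtain ⟨i, ha, hi⟩ := key_lt.1 h
  have hiy : i < y.length := label_lt_top.1 (hi.trans_le le_top)
  have hix : i ≤ x.length := ha.length_le hiy.le
  refine key_lt.2 ⟨i, ((agree_append_left hy).2 ⟨ha.symm, hix⟩).symm, ?_⟩
  rw [label_append]
  split_ifs
  · exact label_lt hy hiy
  · exact hi

lemma key_append_lt_iff {t : ℕ} {x y : List ℕ} (hy : ∀ a ∈ y, a < t) :
    key (x ++ [t]) < key y ↔ key x ≤ key y := by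
  refine Iff.trans ?_ (Iff.trans (not_congr (lt_key_append_iff (x := x) hy)) not_lt)
  refine ⟨fun h => lt_asymm h, fun h => lt_of_le_of_ne (not_lt.1 h) fun e => ?_⟩
  have := label_ne hy x.length
  rw [← key_injective e, label_append, if_pos rfl] at this
  exact this rfl

lemma agree_take_take {k c d : ℕ} {x y : List ℕ} (hc : c ≤ x.length) (hd : d ≤ y.length) :
    Agree k (x.take c) (y.take d) ↔
      Agree (min k (min c d)) x y ∧ (c < d → k ≤ c) ∧ (d < c → k ≤ d) := by
  constructor
  · intro h
    refine ⟨fun i hi => ?_, fun hcd => ?_, fun hcd => ?_⟩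
    · have := h i (by omega)
      rwa [label_take, label_take, if_pos (by omega), if_pos (by omega)] at this
    · by_contra! hk
      have := h c hk
      rw [label_take, label_take, if_neg (by omega), if_pos hcd, eq_comm, label_eq_top] at this
      omega
    · by_contra! hk
      have := h d hk
      rw [label_take, label_take, if_pos hcd, if_neg (by omega), label_eq_top] at this
      omega
  · rintro ⟨h, h1, h2⟩ i hi
    rw [label_take, label_take]
    split_ifs with e1 e2 e2
    · exact h i (by omega)
    · omega
    · omega
    · rfl

lemma key_take_lt_take_iff {c d : ℕ} {x y : List ℕ} (hc : c ≤ x.length) :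
    key (x.take c) < key (y.take d) ↔
      (Agree (min c d) x y ∧ d < c) ∨ (¬ Agree (min c d) x y ∧ key x < key y) := by
  have main : ∀ {c d : ℕ} {x y : List ℕ}, ¬ Agree (min c d) x y → key x < key y →
      key (x.take c) < key (y.take d) := by
    intro c d x y hn h
    obtain ⟨i, ha, hi⟩ := key_lt.1 h
    have him : i < min c d := by
      by_contra! hle
      exact hn (ha.mono hle)
    refine key_lt.2 ⟨i, fun j hj => ?_, ?_⟩
    · rw [label_take, label_take, if_pos (by omega), if_pos (by omega), ha j hj]
    · rwa [label_take, label_take, if_pos (by omega), if_pos (by omega)]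
  by_cases hA : Agree (min c d) x y
  · simp only [hA, true_and, not_true, false_and, or_false]
    constructor
    · intro h
      obtain ⟨i, ha, hi⟩ := key_lt.1 h
      rw [label_take, label_take] at hi
      by_contra! hcd
      split_ifs at hi with e1 e2 e2
      · exact hi.ne (hA i (by omega))
      · omega
      · exact not_top_lt hi
      · exact not_top_lt hi
    · intro hcd
      refine key_lt.2 ⟨d, fun j hj => ?_, ?_⟩
      · rw [label_take, label_take, if_pos (by omega), if_pos (by omega), hA j (by omega)]
      · rw [label_take, label_take, if_pos hcd, if_neg (by omega), label_lt_top]; omega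
  · simp only [hA, false_and, false_or, not_false_iff, true_and]
    refine ⟨fun h => ?_, main hA⟩
    rcases lt_trichotomy (key x) (key y) with h' | h' | h'
    · exact h'
    · exact (hA (key_injective h' ▸ Agree.refl _ _)).elim
    · rw [min_comm, agree_comm] at hA
      exact (lt_asymm h (main hA h')).elim

/-- A history tree over `Q`, with nodes named by paths of birth times: `path q` is the deepest node
hosting the state `q`, for every `q` in the set `live`, and `time` exceeds all birth times. -/
structure Tree (Q : Type) where
  time : ℕ
  live : Set Q
  path : Q → List ℕ

variable {Q : Type}

/-- Every prefix of the path of a live state is the path of a live state, and all birth times are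
in the past. -/
structure Tree.Valid (s : Tree Q) : Prop where
  closed : ∀ q ∈ s.live, ∀ k ≤ (s.path q).length, ∃ p ∈ s.live, s.path p = (s.path q).take k
  fresh : ∀ q ∈ s.live, ∀ a ∈ s.path q, a < s.time

/-- The families of paths `x` and `y` have, on `S`, the same shape. -/
structure SameShape (S : Set Q) (x y : Q → List ℕ) : Prop where
  length : ∀ q ∈ S, (x q).length = (y q).length
  agree : ∀ p ∈ S, ∀ q ∈ S, ∀ k, Agree k (x p) (x q) ↔ Agree k (y p) (y q)
  lt : ∀ p ∈ S, ∀ q ∈ S, key (x p) < key (x q) ↔ key (y p) < key (y q)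

lemma SameShape.le {S : Set Q} {x y : Q → List ℕ} (h : SameShape S x y) {p q : Q} (hp : p ∈ S)
    (hq : q ∈ S) : key (x p) ≤ key (x q) ↔ key (y p) ≤ key (y q) :=
  not_lt.symm.trans ((not_congr (h.lt q hq p hp)).trans not_lt)

lemma SameShape.eq {S : Set Q} {x y : Q → List ℕ} (h : SameShape S x y) {p q : Q} (hp : p ∈ S)
    (hq : q ∈ S) : x p = x q ↔ y p = y q := by
  constructor <;> intro e
  · exact key_injective (le_antisymm ((h.le hp hq).1 (by rw [e])) ((h.le hq hp).1 (by rw [e])))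
  · exact key_injective (le_antisymm ((h.le hp hq).2 (by rw [e])) ((h.le hq hp).2 (by rw [e])))

/-- The depth at which the path `g q` is cut when every node without states of its own absorbs its
descendants. -/
noncomputable def cut (S : Set Q) (g : Q → List ℕ) (q : Q) : ℕ :=
  sInf {k | (g q).length ≤ k ∨ ¬ ∃ p ∈ S, (g p).length = k ∧ Agree k (g p) (g q)}

lemma cut_le (S : Set Q) (g : Q → List ℕ) (q : Q) : cut S g q ≤ (g q).length :=
  Nat.sInf_le (Or.inl le_rfl)

lemma cut_spec (S : Set Q) (g : Q → List ℕ) (q : Q) : (g q).length ≤ cut S g q ∨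
    ¬ ∃ p ∈ S, (g p).length = cut S g q ∧ Agree (cut S g q) (g p) (g q) :=
  Nat.sInf_mem (s := {k | (g q).length ≤ k ∨ ¬ ∃ p ∈ S, (g p).length = k ∧ Agree k (g p) (g q)})
    ⟨_, Or.inl le_rfl⟩

lemma exists_of_lt_cut {S : Set Q} {g : Q → List ℕ} {q : Q} {k : ℕ} (h : k < cut S g q) :
    ∃ p ∈ S, (g p).length = k ∧ Agree k (g p) (g q) := by
  have := Nat.notMem_of_lt_sInf h
  simp only [Set.mem_ofPred_eq, not_or, not_not] at this
  exact this.2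

lemma cut_congr {S : Set Q} {x y : Q → List ℕ} (h : SameShape S x y) {q : Q} (hq : q ∈ S) :
    cut S x q = cut S y q := by
  unfold cut
  congr 1
  ext k
  refine or_congr (by rw [h.length q hq]) (not_congr (exists_congr fun p => and_congr_right
    fun hp => ?_))
  rw [h.length p hp, h.agree p hp q hq]

lemma length_take_cut (S : Set Q) (g : Q → List ℕ) (q : Q) :
    ((g q).take (cut S g q)).length = cut S g q := by
  simp [cut_le]

/-- Collapsing trees of the same shape gives trees of the same shape. -/
lemma SameShape.take_cut {S : Set Q} {x y : Q → List ℕ} (h : SameShape S x y) :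
    SameShape S (fun q => (x q).take (cut S x q)) (fun q => (y q).take (cut S y q)) where
  length q hq := (length_take_cut S x q).trans
    ((cut_congr h hq).trans (length_take_cut S y q).symm)
  agree p hp q hq k := by
    refine (agree_take_take (cut_le _ _ _) (cut_le _ _ _)).trans
      (Iff.trans ?_ (agree_take_take (cut_le _ _ _) (cut_le _ _ _)).symm)
    simp only [cut_congr h hp, cut_congr h hq, h.agree p hp q hq]
  lt p hp q hq := by
    refine (key_take_lt_take_iff (cut_le _ _ _)).trans
      (Iff.trans ?_ (key_take_lt_take_iff (cut_le _ _ _)).symm)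
    simp only [cut_congr h hp, cut_congr h hq, h.agree p hp q hq, h.lt p hp q hq]

namespace Tree

variable (T : Q → Set Q) (F : Set Q) (s : Tree Q)

/-- The set of successors of the live states. -/
def succ : Set Q := {q | ∃ p ∈ s.live, q ∈ T p}

/-- The predecessor of `q` whose path has the least key. -/
noncomputable def parent (q : Q) : Q :=
  haveI : Nonempty Q := ⟨q⟩
  Classical.epsilon fun p => (p ∈ s.live ∧ q ∈ T p) ∧
    ∀ p', p' ∈ s.live ∧ q ∈ T p' → key (s.path p) ≤ key (s.path p')

open Classical in
/-- The path of `q` after a transition, before collapsing. -/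
noncomputable def raw (q : Q) : List ℕ :=
  if q ∈ F then s.path (s.parent T q) ++ [s.time] else s.path (s.parent T q)

/-- The transition on history trees. -/
noncomputable def step : Tree Q where
  time := s.time + 1
  live := s.succ T
  path q := (s.raw T F q).take (cut (s.succ T) (s.raw T F) q)

variable {T F s}

lemma parent_spec [Finite Q] {q : Q} (hq : q ∈ s.succ T) :
    (s.parent T q ∈ s.live ∧ q ∈ T (s.parent T q)) ∧
      ∀ p', p' ∈ s.live ∧ q ∈ T p' → key (s.path (s.parent T q)) ≤ key (s.path p') := by
  have : Nonempty Q := ⟨q⟩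
  obtain ⟨p, hp⟩ := hq
  obtain ⟨m, hm, hmin⟩ := Set.exists_min_image {p | p ∈ s.live ∧ q ∈ T p}
    (fun p => key (s.path p)) (Set.toFinite _) ⟨p, hp⟩
  exact Classical.epsilon_spec
    (p := fun p => (p ∈ s.live ∧ q ∈ T p) ∧
      ∀ p', p' ∈ s.live ∧ q ∈ T p' → key (s.path p) ≤ key (s.path p')) ⟨m, hm, hmin⟩

lemma raw_cases (T : Q → Set Q) (F : Set Q) (s : Tree Q) (q : Q) :
    (q ∈ F ∧ s.raw T F q = s.path (s.parent T q) ++ [s.time]) ∨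
      (q ∉ F ∧ s.raw T F q = s.path (s.parent T q)) := by
  by_cases h : q ∈ F <;> simp [raw, h]

lemma length_step (q : Q) :
    ((s.step T F).path q).length = cut (s.succ T) (s.raw T F) q :=
  length_take_cut _ _ _

lemma Valid.step [Finite Q] (hs : s.Valid) : (s.step T F).Valid where
  closed q hq k hk := by
    rw [length_step] at hk
    rcases hk.lt_or_eq with hk | rfl
    · obtain ⟨p, hp, hl, ha⟩ := exists_of_lt_cut hk
      refine ⟨p, hp, ?_⟩
      have hraw : s.raw T F p = (s.raw T F q).take k :=
        (eq_take_iff (hk.le.trans (cut_le _ _ _))).2 ⟨hl, ha⟩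
      have hc : cut (s.succ T) (s.raw T F) p = k := by
        refine le_antisymm (hl ▸ cut_le _ _ _) ?_
        by_contra! hlt
        rcases cut_spec (s.succ T) (s.raw T F) p with h | h
        · omega
        · obtain ⟨r, hr, hrl, hra⟩ := exists_of_lt_cut (hlt.trans hk)
          exact h ⟨r, hr, hrl, hra.trans (ha.symm.mono hlt.le)⟩
      change (s.raw T F p).take _ = ((s.raw T F q).take _).take k
      rw [hc, List.take_take, min_eq_left hk.le, hraw, List.take_take, min_self]
    · refine ⟨q, hq, (List.take_of_length_le ?_).symm⟩
      rw [length_step]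
  fresh q hq a ha := by
    have h := hs.fresh _ (parent_spec hq).1.1
    have ha := List.mem_of_mem_take ha
    change a < s.time + 1
    rcases raw_cases T F s q with ⟨-, e⟩ | ⟨-, e⟩ <;> rw [e] at ha
    · rcases List.mem_append.1 ha with ha | ha
      · exact (h a ha).trans (Nat.lt_succ_self _)
      · simp only [List.mem_singleton] at ha
        omega
    · exact (h a ha).trans (Nat.lt_succ_self _)

lemma succ_congr {s' : Tree Q} (hl : s.live = s'.live) : s.succ T = s'.succ T := by
  simp only [succ, hl]

lemma path_parent_congr [Finite Q] {s' : Tree Q} (hl : s.live = s'.live)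
    (h : SameShape s.live s.path s'.path) {q : Q} (hq : q ∈ s.succ T) :
    s.path (s.parent T q) = s.path (s'.parent T q) := by
  have h1 := parent_spec hq
  have h2 := parent_spec (succ_congr (T := T) hl ▸ hq)
  rw [← hl] at h2
  exact key_injective (le_antisymm (h1.2 _ h2.1) ((h.le h2.1.1 h1.1.1).2 (h2.2 _ h1.1)))

lemma raw_eq [Finite Q] {s' : Tree Q} (hl : s.live = s'.live)
    (h : SameShape s.live s.path s'.path) {q : Q} (hq : q ∈ s.succ T) :
    ∃ p ∈ s.live,
      (q ∈ F ∧ s.raw T F q = s.path p ++ [s.time] ∧ s'.raw T F q = s'.path p ++ [s'.time]) ∨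
      (q ∉ F ∧ s.raw T F q = s.path p ∧ s'.raw T F q = s'.path p) := by
  have h2 := parent_spec (succ_congr (T := T) hl ▸ hq)
  refine ⟨s'.parent T q, hl ▸ h2.1.1, ?_⟩
  by_cases hF : q ∈ F <;> simp [raw, hF, path_parent_congr hl h hq]

lemma sameShape_raw [Finite Q] {s' : Tree Q} (hs : s.Valid) (hs' : s'.Valid)
    (hl : s.live = s'.live) (h : SameShape s.live s.path s'.path) :
    SameShape (s.succ T) (s.raw T F) (s'.raw T F) where
  length q hq := by
    obtain ⟨p, hp, ⟨-, e, e'⟩ | ⟨-, e, e'⟩⟩ := raw_eq (F := F) hl h hq <;>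
      simp [e, e', h.length p hp]
  agree q hq r hr k := by
    have hf := hs.fresh
    have hf' := hs'.fresh
    rw [← hl] at hf'
    obtain ⟨p, hp, ⟨-, e, e'⟩ | ⟨-, e, e'⟩⟩ := raw_eq (F := F) hl h hq <;>
    obtain ⟨m, hm, ⟨-, i, i'⟩ | ⟨-, i, i'⟩⟩ := raw_eq (F := F) hl h hr <;>
    rw [e, e', i, i']
    · rw [agree_append_append (hf p hp) (hf m hm), agree_append_append (hf' p hp) (hf' m hm),
        h.agree p hp m hm]
    · rw [agree_append_left (hf m hm), agree_append_left (hf' m hm), h.agree p hp m hm,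
        h.length p hp]
    · rw [agree_comm, agree_comm (x := s'.path p), agree_append_left (hf p hp),
        agree_append_left (hf' p hp), h.agree m hm p hp, h.length m hm]
    · rw [h.agree p hp m hm]
  lt q hq r hr := by
    have hf := hs.fresh
    have hf' := hs'.fresh
    rw [← hl] at hf'
    obtain ⟨p, hp, ⟨-, e, e'⟩ | ⟨-, e, e'⟩⟩ := raw_eq (F := F) hl h hq <;>
    obtain ⟨m, hm, ⟨-, i, i'⟩ | ⟨-, i, i'⟩⟩ := raw_eq (F := F) hl h hr <;>
    rw [e, e', i, i']
    · rw [key_append_lt_append_iff (hf p hp) (hf m hm),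
        key_append_lt_append_iff (hf' p hp) (hf' m hm), h.lt p hp m hm]
    · rw [key_append_lt_iff (hf m hm), key_append_lt_iff (hf' m hm), h.le hp hm]
    · rw [lt_key_append_iff (hf p hp), lt_key_append_iff (hf' p hp), h.lt p hp m hm]
    · rw [h.lt p hp m hm]

lemma sameShape_step [Finite Q] {s' : Tree Q} (hs : s.Valid) (hs' : s'.Valid)
    (hl : s.live = s'.live) (h : SameShape s.live s.path s'.path) :
    SameShape (s.step T F).live (s.step T F).path (s'.step T F).path := by
  have := (sameShape_raw (T := T) (F := F) hs hs' hl h).take_cut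
  simp only [step, ← succ_congr (T := T) hl]
  exact this

/-- The number of live states whose path precedes that of `q`. -/
noncomputable def rank (s : Tree Q) (q : Q) : ℕ :=
  {p | p ∈ s.live ∧ key (s.path p) < key (s.path q)}.ncard

lemma Valid.card_le_ncard [Finite Q] (hs : s.Valid) {q : Q} (hq : q ∈ s.live) {I : Finset ℕ}
    (hI : ∀ k ∈ I, k ≤ (s.path q).length) {P : Set Q}
    (hP : ∀ k ∈ I, ∀ p ∈ s.live, s.path p = (s.path q).take k → p ∈ P) : I.card ≤ P.ncard := by
  have h : ∀ k : I, ∃ p ∈ s.live, s.path p = (s.path q).take k :=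
    fun k => hs.closed q hq k (hI k k.2)
  choose f hf hfp using h
  have hinj : Function.Injective f := by
    intro j k e
    have hj := congrArg List.length (hfp j)
    have hk := congrArg List.length (hfp k)
    rw [List.length_take_of_le (hI j j.2)] at hj
    rw [List.length_take_of_le (hI k k.2), ← e, hj] at hk
    exact Subtype.ext hk
  have h1 := Set.ncard_range_of_injective hinj
  have h2 : Set.range f ⊆ P := by
    rintro _ ⟨k, rfl⟩
    exact hP k k.2 _ (hf k) (hfp k)
  have h3 := Set.ncard_le_ncard h2 (Set.toFinite P)
  simpa [h1] using h3

lemma Valid.length_lt [Finite Q] (hs : s.Valid) {q : Q} (hq : q ∈ s.live) :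
    (s.path q).length < Nat.card Q := by
  have := hs.card_le_ncard hq (I := Finset.range ((s.path q).length + 1)) (P := Set.univ)
    (fun k hk => by simp at hk; omega) (fun _ _ _ _ _ => Set.mem_univ _)
  simpa [Set.ncard_univ, Nat.succ_le_iff] using this

lemma rank_lt [Finite Q] (s : Tree Q) (q : Q) : s.rank q < Nat.card Q :=
  Set.ncard_lt_card fun h => lt_irrefl _ ((Set.eq_univ_iff_forall.1 h) q).2

/-- The position of a live state in an encoding of ranks and depths by one number. -/
noncomputable def position (s : Tree Q) (q : Q) : ℕ := 2 * s.rank q + (s.path q).length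

lemma Valid.position_lt [Finite Q] (hs : s.Valid) {p q : Q} (hp : p ∈ s.live)
    (h : key (s.path p) < key (s.path q)) : s.position p < s.position q := by
  obtain ⟨i, ha, hi⟩ := key_lt.1 h
  have hip : i < (s.path p).length := label_lt_top.1 (hi.trans_le le_top)
  have hiq : i ≤ (s.path q).length := ha.length_le hip.le
  set P : Set Q := {r | r ∈ s.live ∧ key (s.path p) ≤ key (s.path r) ∧
    key (s.path r) < key (s.path q)}
  have hsum : s.rank q = s.rank p + P.ncard := by
    unfold rank
    rw [← Set.ncard_union_eq]
    · congr 1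
      ext r
      constructor
      · rintro ⟨hr, hlt⟩
        rcases lt_or_ge (key (s.path r)) (key (s.path p)) with h' | h'
        · exact Or.inl ⟨hr, h'⟩
        · exact Or.inr ⟨hr, h', hlt⟩
      · rintro (⟨hr, h'⟩ | ⟨hr, -, h'⟩)
        · exact ⟨hr, h'.trans h⟩
        · exact ⟨hr, h'⟩
    · rw [Set.disjoint_left]
      rintro r ⟨-, h1⟩ ⟨-, h2, -⟩
      exact (not_lt.2 h2) h1
  have hpos : 0 < P.ncard := (Set.ncard_pos).2 ⟨p, hp, le_rfl, h⟩
  have hcard : (s.path p).length - (s.path q).length ≤ P.ncard := by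
    have := hs.card_le_ncard hp (P := P)
      (I := Finset.Ioc (s.path q).length (s.path p).length) (fun k hk => (Finset.mem_Ioc.1 hk).2)
      (fun k hk r hr e => ?_)
    · simpa using this
    · have hk := Finset.mem_Ioc.1 hk
      refine ⟨hr, ?_, ?_⟩
      · rw [e]
        rcases hk.2.lt_or_eq with hlt | rfl
        · refine le_of_lt (key_lt.2 ⟨k, agree_take_left.symm, ?_⟩)
          rw [label_take, if_neg (lt_irrefl k), label_lt_top]
          exact hlt
        · rw [List.take_length]
      · rw [e]
        refine key_lt.2 ⟨i, fun j hj => ?_, ?_⟩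
        · rw [label_take, if_pos (by omega), ha j hj]
        · rwa [label_take, if_pos (by omega)]
  unfold position
  omega

lemma Valid.position_lt_iff [Finite Q] (hs : s.Valid) {p q : Q} (hp : p ∈ s.live)
    (hq : q ∈ s.live) : s.position p < s.position q ↔ key (s.path p) < key (s.path q) := by
  refine ⟨fun h => ?_, hs.position_lt hp⟩
  rcases lt_trichotomy (key (s.path p)) (key (s.path q)) with h' | h' | h'
  · exact h'
  · simp only [position, rank, key_injective h'] at h
    exact (lt_irrefl _ h).elim
  · exact (lt_asymm h (hs.position_lt hq h')).elim

/-- In a closed tree, agreement of paths can be read off the depths of the nodes in between. -/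
lemma Valid.agree_iff (hs : s.Valid) {p q : Q} (hp : p ∈ s.live)
    (h : key (s.path p) < key (s.path q)) (k : ℕ) :
    Agree k (s.path p) (s.path q) ↔ k ≤ (s.path q).length ∧ ∀ r ∈ s.live,
      key (s.path p) ≤ key (s.path r) → key (s.path r) < key (s.path q) →
        k < (s.path r).length := by
  obtain ⟨i, hi, hil⟩ := key_lt.1 h
  have hip : i < (s.path p).length := label_lt_top.1 (hil.trans_le le_top)
  constructor
  · intro ha
    have hki : k ≤ i := by
      by_contra! hlt
      exact hil.ne (ha i hlt)
    refine ⟨hki.trans (hi.length_le hip.le), fun r hr h1 h2 => ?_⟩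
    obtain ⟨j, hj, hjl⟩ := key_lt.1 h2
    refine lt_of_le_of_lt ?_ (label_lt_top.1 (hjl.trans_le le_top))
    by_contra! hjk
    have : key (s.path r) < key (s.path p) :=
      key_lt.2 ⟨j, fun m hm => (hj m hm).trans (ha m (hm.trans hjk)).symm, by rwa [ha j hjk]⟩
    exact (not_lt.2 h1) this
  · rintro ⟨-, hr⟩
    by_contra hn
    have hik : i < k := by
      by_contra! hle
      exact hn (hi.mono hle)
    obtain ⟨r, hrl, e⟩ := hs.closed p hp (i + 1) hip
    have := hr r hrl ?_ ?_
    · rw [e, List.length_take_of_le hip] at this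
      omega
    · rw [e]
      rcases Nat.lt_or_ge (i + 1) (s.path p).length with hlt | hge
      · refine le_of_lt (key_lt.2 ⟨i + 1, agree_take_left.symm, ?_⟩)
        rw [label_take, if_neg (lt_irrefl _), label_lt_top]
        exact hlt
      · rw [List.take_of_length_le hge]
    · rw [e]
      refine key_lt.2 ⟨i, (agree_take_left.mono (Nat.le_succ i)).trans hi, ?_⟩
      rwa [label_take, if_pos (Nat.lt_succ_self i)]

lemma Valid.sameShape [Finite Q] {s' : Tree Q} (hs : s.Valid) (hs' : s'.Valid)
    (hl : s.live = s'.live) (h : ∀ q ∈ s.live, s.position q = s'.position q) :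
    SameShape s.live s.path s'.path := by
  have hlt : ∀ p ∈ s.live, ∀ q ∈ s.live,
      key (s.path p) < key (s.path q) ↔ key (s'.path p) < key (s'.path q) := by
    intro p hp q hq
    rw [← hs.position_lt_iff hp hq, ← hs'.position_lt_iff (hl ▸ hp) (hl ▸ hq), h p hp, h q hq]
  have hle : ∀ p ∈ s.live, ∀ q ∈ s.live,
      key (s.path p) ≤ key (s.path q) ↔ key (s'.path p) ≤ key (s'.path q) :=
    fun p hp q hq => not_lt.symm.trans ((not_congr (hlt q hq p hp)).trans not_lt)
  have hlen : ∀ q ∈ s.live, (s.path q).length = (s'.path q).length := by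
    intro q hq
    have hr : s.rank q = s'.rank q := by
      unfold rank
      congr 1
      ext p
      exact ⟨fun hp => ⟨hl ▸ hp.1, (hlt p hp.1 q hq).1 hp.2⟩,
        fun hp => ⟨hl ▸ hp.1, (hlt p (hl ▸ hp.1) q hq).2 hp.2⟩⟩
    have := h q hq
    unfold position at this
    omega
  have hag : ∀ p ∈ s.live, ∀ q ∈ s.live, key (s.path p) < key (s.path q) → ∀ k,
      Agree k (s.path p) (s.path q) ↔ Agree k (s'.path p) (s'.path q) := by
    intro p hp q hq hpq k
    rw [hs.agree_iff hp hpq, hs'.agree_iff (hl ▸ hp) ((hlt p hp q hq).1 hpq), hlen q hq, ← hl]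
    refine and_congr_right fun _ => forall₂_congr fun r hr => ?_
    rw [hle p hp r hr, hlt r hr q hq, hlen r hr]
  refine ⟨hlen, fun p hp q hq k => ?_, hlt⟩
  rcases lt_trichotomy (key (s.path p)) (key (s.path q)) with h' | h' | h'
  · exact hag p hp q hq h' k
  · have e : key (s'.path p) = key (s'.path q) :=
      le_antisymm ((hle p hp q hq).1 h'.le) ((hle q hq p hp).1 h'.ge)
    rw [key_injective h', key_injective e]
    exact iff_of_true (Agree.refl _ _) (Agree.refl _ _)
  · rw [agree_comm, agree_comm (x := s'.path p)]
    exact hag q hq p hp h' k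

lemma position_congr {s' : Tree Q} (hl : s.live = s'.live)
    (h : SameShape s.live s.path s'.path) {q : Q} (hq : q ∈ s.live) :
    s.position q = s'.position q := by
  unfold position rank
  rw [h.length q hq]
  congr 3
  ext p
  exact ⟨fun hp => ⟨hl ▸ hp.1, (h.lt p hp.1 q hq).1 hp.2⟩,
    fun hp => ⟨hl ▸ hp.1, (h.lt p (hl ▸ hp.1) q hq).2 hp.2⟩⟩

open Classical in
/-- The finite code of a history tree. -/
noncomputable def code (s : Tree Q) (q : Q) : Fin (3 * Nat.card Q + 1) :=
  Fin.ofNat _ (if q ∈ s.live then s.position q else 3 * Nat.card Q)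

lemma Valid.position_lt_card [Finite Q] (hs : s.Valid) {q : Q} (hq : q ∈ s.live) :
    s.position q < 3 * Nat.card Q := by
  have h1 := s.rank_lt q
  have h2 := hs.length_lt hq
  unfold position
  omega

lemma Valid.code_val [Finite Q] (hs : s.Valid) {q : Q} (hq : q ∈ s.live) :
    (s.code q : ℕ) = s.position q := by
  have := hs.position_lt_card hq
  simp only [code, hq, if_true, Fin.ofNat]
  exact Nat.mod_eq_of_lt (by omega)

lemma code_val_of_notMem {q : Q} (hq : q ∉ s.live) : (s.code q : ℕ) = 3 * Nat.card Q := by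
  simp only [code, hq, if_false, Fin.ofNat]
  exact Nat.mod_eq_of_lt (by omega)

lemma Valid.mem_live_iff [Finite Q] (hs : s.Valid) {q : Q} :
    q ∈ s.live ↔ (s.code q : ℕ) < 3 * Nat.card Q := by
  refine ⟨fun hq => (hs.code_val hq).trans_lt (hs.position_lt_card hq), fun h => ?_⟩
  by_contra hq
  exact h.ne (code_val_of_notMem hq)

lemma Valid.of_code_eq [Finite Q] {s' : Tree Q} (hs : s.Valid) (hs' : s'.Valid)
    (h : s.code = s'.code) : s.live = s'.live ∧ SameShape s.live s.path s'.path := by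
  have hl : s.live = s'.live := by
    ext q
    rw [hs.mem_live_iff, hs'.mem_live_iff, h]
  refine ⟨hl, hs.sameShape hs' hl fun q hq => ?_⟩
  rw [← hs.code_val hq, ← hs'.code_val (hl ▸ hq), h]

lemma code_congr {s' : Tree Q} (hl : s.live = s'.live)
    (h : SameShape s.live s.path s'.path) : s.code = s'.code := by
  funext q
  by_cases hq : q ∈ s.live
  · have hq' := hl ▸ hq
    simp only [code, hq, hq', position_congr hl h hq]
  · have hq' := hl ▸ hq
    simp only [code, hq, hq', if_false]

/-- The nodes of depth at most `j` that are a prefix of `u` or an older sibling of one. -/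
def elders (s : Tree Q) (u : List ℕ) (j : ℕ) : Set (List ℕ) :=
  {x | x ∈ s.path '' s.live ∧ x.length ≠ 0 ∧ x.length ≤ j ∧ Agree (x.length - 1) x u ∧
    label x (x.length - 1) ≤ label u (x.length - 1)}

/-- The name of a node: it identifies the node within a given tree, depends only on the shape of
the tree, and eventually stabilizes for a node that never dies. -/
noncomputable def name (s : Tree Q) (u : List ℕ) : Finset ℕ :=
  (Finset.range (u.length + 1)).image fun j => (s.elders u j).ncard

lemma finite_elders [Finite Q] (s : Tree Q) (u : List ℕ) (j : ℕ) : (s.elders u j).Finite :=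
  ((Set.toFinite s.live).image s.path).subset fun _ hx => hx.1

lemma elders_mono (s : Tree Q) (u : List ℕ) {i j : ℕ} (h : i ≤ j) :
    s.elders u i ⊆ s.elders u j :=
  fun _ ⟨h1, h2, h3, h4⟩ => ⟨h1, h2, h3.trans h, h4⟩

lemma elders_subset_of_agree {u v : List ℕ} {j : ℕ} (h : Agree j u v) :
    s.elders u j ⊆ s.elders v j :=
  fun x ⟨h1, h2, h3, h4, h5⟩ =>
    ⟨h1, h2, h3, h4.trans (h.mono (by omega)), h5.trans_eq (h _ (by omega))⟩

lemma name_subset [Finite Q] (s : Tree Q) (u : List ℕ) :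
    s.name u ⊆ Finset.range (Nat.card Q + 1) := by
  intro m hm
  obtain ⟨j, -, rfl⟩ := Finset.mem_image.1 hm
  rw [Finset.mem_range, Nat.lt_succ_iff]
  refine (Set.ncard_le_ncard (fun _ hx => hx.1) ((Set.toFinite s.live).image s.path)).trans ?_
  exact (Set.ncard_image_le (Set.toFinite _)).trans (Set.ncard_le_card _)

lemma Valid.name_ne [Finite Q] (hs : s.Valid) {u v : List ℕ} (hu : u ∈ s.path '' s.live)
    (hv : v ∈ s.path '' s.live) (h : key v < key u) : s.name u ≠ s.name v := by
  obtain ⟨p, hp, rfl⟩ := hu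
  obtain ⟨q, hq, rfl⟩ := hv
  obtain ⟨i, ha, hi⟩ := key_lt.1 h
  have hiv : i < (s.path q).length := label_lt_top.1 (hi.trans_le le_top)
  have hmem : (s.elders (s.path q) (i + 1)).ncard ∈ s.name (s.path q) :=
    Finset.mem_image.2 ⟨i + 1, Finset.mem_range.2 (by omega), rfl⟩
  intro e
  rw [← e] at hmem
  obtain ⟨j, hj, hcard⟩ := Finset.mem_image.1 hmem
  rw [Finset.mem_range] at hj
  have htake : ∀ r ∈ s.live, i < (s.path r).length →
      (s.path r).take (i + 1) ∈ s.elders (s.path r) (i + 1) := by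
    intro r hr hlen
    obtain ⟨m, hm, hmp⟩ := hs.closed r hr (i + 1) hlen
    have hl : ((s.path r).take (i + 1)).length = i + 1 := List.length_take_of_le hlen
    refine ⟨⟨m, hm, hmp⟩, by omega, hl.le, agree_take_left.mono (by omega), ?_⟩
    rw [hl, Nat.add_sub_cancel, label_take, if_pos (Nat.lt_succ_self i)]
  rcases Nat.lt_or_ge i j with hij | hij
  · refine (Set.ncard_lt_ncard (s := s.elders (s.path q) (i + 1))
      (t := s.elders (s.path p) j) ?_ (finite_elders _ _ _)).ne hcard.symm
    have hsub : s.elders (s.path q) (i + 1) ⊆ s.elders (s.path p) j := by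
      rintro x ⟨h1, h2, h3, h4, h5⟩
      refine ⟨h1, h2, by omega, h4.trans (ha.mono (by omega)), h5.trans ?_⟩
      rcases Nat.lt_or_ge (x.length - 1) i with hlt | hge
      · exact (ha _ hlt).le
      · rw [show x.length - 1 = i by omega]
        exact hi.le
    refine ⟨hsub, fun hsup => ?_⟩
    have hlen : i < (s.path p).length := by omega
    have hl : ((s.path p).take (i + 1)).length = i + 1 := List.length_take_of_le hlen
    have := (hsup (elders_mono s _ hij (htake p hp hlen))).2.2.2.2
    rw [hl, Nat.add_sub_cancel, label_take, if_pos (Nat.lt_succ_self i)] at this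
    exact (not_lt.2 this) hi
  · refine (Set.ncard_lt_ncard (s := s.elders (s.path p) j)
      (t := s.elders (s.path q) (i + 1)) ?_ (finite_elders _ _ _)).ne hcard
    refine ⟨(elders_subset_of_agree (ha.symm.mono hij)).trans (elders_mono s _ (by omega)),
      fun hsup => ?_⟩
    have := (hsup (htake q hq hiv)).2.2.1
    rw [List.length_take_of_le hiv] at this
    omega

lemma Valid.name_injOn [Finite Q] (hs : s.Valid) : Set.InjOn s.name (s.path '' s.live) := by
  intro u hu v hv e
  rcases lt_trichotomy (key u) (key v) with h | h | h
  · exact (hs.name_ne hv hu h e.symm).elim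
  · exact key_injective h
  · exact (hs.name_ne hu hv h e).elim

end Tree

lemma ncard_image_le_of_factor {α β γ : Type*} {A : Set α} (hA : A.Finite) {f : α → β}
    {g : α → γ} (h : ∀ a ∈ A, ∀ b ∈ A, f a = f b → g a = g b) :
    (g '' A).ncard ≤ (f '' A).ncard := by
  classical
  rcases A.eq_empty_or_nonempty with rfl | ⟨a₀, -⟩
  · simp
  let φ : β → γ := fun y => if hy : ∃ a ∈ A, f a = y then g hy.choose else g a₀
  have hsub : g '' A ⊆ φ '' (f '' A) := by
    rintro _ ⟨a, ha, rfl⟩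
    refine ⟨f a, ⟨a, ha, rfl⟩, ?_⟩
    have hy : ∃ b ∈ A, f b = f a := ⟨a, ha, rfl⟩
    simp only [φ, hy, dif_pos]
    exact h _ hy.choose_spec.1 _ ha hy.choose_spec.2
  exact (Set.ncard_le_ncard hsub ((hA.image f).image φ)).trans (Set.ncard_image_le (hA.image f))

namespace Tree

variable {T : Q → Set Q} {F : Set Q} {s : Tree Q}

lemma elders_eq (u : List ℕ) (j : ℕ) : s.elders u j =
    s.path '' {p | p ∈ s.live ∧ (s.path p).length ≠ 0 ∧ (s.path p).length ≤ j ∧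
      Agree ((s.path p).length - 1) (s.path p) u ∧
      (Agree (s.path p).length (s.path p) u ∨ key (s.path p) < key u)} := by
  have key_iff : ∀ x : List ℕ, x.length ≠ 0 → Agree (x.length - 1) x u →
      (label x (x.length - 1) ≤ label u (x.length - 1) ↔
        Agree x.length x u ∨ key x < key u) := by
    intro x h0 ha
    constructor
    · intro hle
      rcases hle.eq_or_lt with he | hlt
      · refine Or.inl fun i hi => ?_
        rcases Nat.lt_or_ge i (x.length - 1) with h | h
        · exact ha i h
        · rwa [show i = x.length - 1 by omega]
      · exact Or.inr (key_lt.2 ⟨_, ha, hlt⟩)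
    · rintro (h | h)
      · exact (h _ (by omega)).le
      · obtain ⟨i, hi, hlt⟩ := key_lt.1 h
        have hix : i < x.length := label_lt_top.1 (hlt.trans_le le_top)
        have : x.length - 1 ≤ i := by
          by_contra! hc
          exact hlt.ne (ha i hc)
        rw [show x.length - 1 = i by omega]
        exact hlt.le
  ext x
  constructor
  · rintro ⟨⟨p, hp, rfl⟩, h2, h3, h4, h5⟩
    exact ⟨p, ⟨hp, h2, h3, h4, (key_iff _ h2 h4).1 h5⟩, rfl⟩
  · rintro ⟨p, ⟨hp, h2, h3, h4, h5⟩, rfl⟩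
    exact ⟨⟨p, hp, rfl⟩, h2, h3, h4, (key_iff _ h2 h4).2 h5⟩

lemma name_congr [Finite Q] {s' : Tree Q} (hl : s.live = s'.live)
    (h : SameShape s.live s.path s'.path) {q : Q} (hq : q ∈ s.live) :
    s.name (s.path q) = s'.name (s'.path q) := by
  unfold name
  rw [h.length q hq]
  congr 1
  funext j
  rw [elders_eq, elders_eq, ← hl]
  have hset : {p | p ∈ s.live ∧ (s'.path p).length ≠ 0 ∧ (s'.path p).length ≤ j ∧
      Agree ((s'.path p).length - 1) (s'.path p) (s'.path q) ∧
      (Agree (s'.path p).length (s'.path p) (s'.path q) ∨ key (s'.path p) < key (s'.path q))} =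
      {p | p ∈ s.live ∧ (s.path p).length ≠ 0 ∧ (s.path p).length ≤ j ∧
      Agree ((s.path p).length - 1) (s.path p) (s.path q) ∧
      (Agree (s.path p).length (s.path p) (s.path q) ∨ key (s.path p) < key (s.path q))} := by
    ext p
    refine and_congr_right fun hp => ?_
    rw [h.length p hp, h.agree p hp q hq, h.agree p hp q hq, h.lt p hp q hq]
  rw [hset]
  refine le_antisymm (ncard_image_le_of_factor (Set.toFinite _) fun a ha b hb => ?_)
    (ncard_image_le_of_factor (Set.toFinite _) fun a ha b hb => ?_)
  · exact (h.eq ha.1 hb.1).2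
  · exact (h.eq ha.1 hb.1).1

/-- In a transition, the node of `q` flashes: it absorbs its descendants. -/
def Flash (T : Q → Set Q) (F : Set Q) (s : Tree Q) (q : Q) : Prop :=
  (s.step T F).path q ≠ s.raw T F q

/-- In a transition, the node of `q` was already present and keeps its name. -/
def Stable (T : Q → Set Q) (F : Set Q) (s : Tree Q) (q : Q) : Prop :=
  ∃ p ∈ s.live, s.path p = (s.step T F).path q ∧
    s.name (s.path p) = (s.step T F).name ((s.step T F).path q)

lemma flash_iff {q : Q} :
    s.Flash T F q ↔ cut (s.succ T) (s.raw T F) q < (s.raw T F q).length := by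
  rw [Flash, ← not_iff_not, not_not, not_lt]
  exact List.take_eq_self_iff _

lemma flash_congr [Finite Q] {s' : Tree Q} (hs : s.Valid) (hs' : s'.Valid)
    (hl : s.live = s'.live) (h : SameShape s.live s.path s'.path) {q : Q} (hq : q ∈ s.succ T) :
    s.Flash T F q ↔ s'.Flash T F q := by
  have := sameShape_raw (T := T) (F := F) hs hs' hl h
  rw [flash_iff, flash_iff, this.length q hq, cut_congr this hq, succ_congr hl]

lemma stable_congr [Finite Q] {s' : Tree Q} (hs : s.Valid) (hs' : s'.Valid)
    (hl : s.live = s'.live) (h : SameShape s.live s.path s'.path) {q : Q} (hq : q ∈ s.succ T) :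
    s.Stable T F q ↔ s'.Stable T F q := by
  have hraw := sameShape_raw (T := T) (F := F) hs hs' hl h
  have hstep := sameShape_step (T := T) (F := F) hs hs' hl h
  unfold Stable
  rw [← hl]
  refine exists_congr fun p => and_congr_right fun hp => and_congr ?_ ?_
  · change s.path p = (s.raw T F q).take _ ↔ s'.path p = (s'.raw T F q).take _
    rw [eq_take_iff (cut_le _ _ _), eq_take_iff (cut_le _ _ _), h.length p hp, ← succ_congr hl,
      cut_congr hraw hq]
    refine and_congr_right fun _ => ?_
    obtain ⟨m, hm, ⟨-, e, e'⟩ | ⟨-, e, e'⟩⟩ := raw_eq (F := F) hl h hq <;> rw [e, e']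
    · rw [agree_comm, agree_comm (x := s'.path p), agree_append_left (hs.fresh p hp),
        agree_append_left (hs'.fresh p (hl ▸ hp)), h.agree m hm p hp, h.length m hm]
    · rw [h.agree p hp m hm]
  · rw [name_congr hl h hp, name_congr (succ_congr (T := T) hl) hstep hq]

lemma Valid.mem_image_of_agree (hs : s.Valid) {v : List ℕ} {q : Q} (hq : q ∈ s.live)
    (h : Agree v.length v (s.path q)) : v ∈ s.path '' s.live := by
  have hl := h.length_le le_rfl
  obtain ⟨p, hp, e⟩ := hs.closed q hq _ hl
  exact ⟨p, hp, e.trans ((eq_take_iff hl).2 ⟨rfl, h⟩).symm⟩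

lemma agree_raw {v : List ℕ} {q : Q} (h : Agree v.length v ((s.step T F).path q)) :
    Agree v.length v (s.raw T F q) := by
  have hl := h.length_le le_rfl
  rw [length_step] at hl
  exact h.trans (agree_take_left.mono hl)

lemma Valid.agree_parent (hs : s.Valid) {v : List ℕ} (hv : v ∈ s.path '' s.live) {q : Q}
    (h : Agree v.length v ((s.step T F).path q)) :
    Agree v.length v (s.path (s.parent T q)) := by
  obtain ⟨m, hm, rfl⟩ := hv
  have h := agree_raw h
  rcases raw_cases T F s q with ⟨-, e⟩ | ⟨-, e⟩ <;> rw [e] at h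
  · exact ((agree_append_left (hs.fresh m hm)).1 h.symm).1.symm
  · exact h

lemma length_parent_le_raw (q : Q) : (s.path (s.parent T q)).length ≤ (s.raw T F q).length := by
  rcases raw_cases T F s q with ⟨-, e⟩ | ⟨-, e⟩ <;> simp [e]

lemma label_raw {q : Q} {i : ℕ} (h : i < (s.path (s.parent T q)).length) :
    label (s.raw T F q) i = label (s.path (s.parent T q)) i := by
  rcases raw_cases T F s q with ⟨-, e⟩ | ⟨-, e⟩ <;> rw [e]
  rw [label_append, if_neg h.ne]

lemma Valid.elders_step_subset [Finite Q] (hs : s.Valid) {v : List ℕ}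
    (hv : v ∈ s.path '' s.live) {j : ℕ} (hj : j ≤ v.length) :
    (s.step T F).elders v j ⊆ s.elders v j := by
  obtain ⟨m, hm, rfl⟩ := hv
  rintro _ ⟨⟨q, hq, rfl⟩, h2, h3, h4, h5⟩
  refine ⟨?_, h2, h3, h4, h5⟩
  have hp := (parent_spec hq).1.1
  have hc := cut_le (s.succ T) (s.raw T F) q
  have hpath : (s.step T F).path q = (s.raw T F q).take (cut (s.succ T) (s.raw T F) q) := rfl
  have hlen := length_step (T := T) (F := F) (s := s) q
  set c := cut (s.succ T) (s.raw T F) q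
  have key_fact : c ≤ (s.path (s.parent T q)).length →
      (s.raw T F q).take c = (s.path (s.parent T q)).take c → (s.step T F).path q ∈
        s.path '' s.live := by
    intro hle e
    obtain ⟨p', hp', e'⟩ := hs.closed _ hp c hle
    exact ⟨p', hp', by rw [e', hpath, e]⟩
  rcases raw_cases T F s q with ⟨-, e⟩ | ⟨-, e⟩
  · rcases Nat.lt_or_ge (s.path (s.parent T q)).length c with hlt | hge
    · exfalso
      rw [e, List.length_append, List.length_singleton] at hc
      have hc' : c = (s.path (s.parent T q)).length + 1 := by omega
      rw [hlen, hpath, hc', Nat.add_sub_cancel, label_take, if_pos (Nat.lt_succ_self _), e,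
        label_append, if_pos rfl] at h5
      exact (not_lt.2 h5) (label_lt (hs.fresh m hm) (by omega))
    · exact key_fact hge (by rw [e, List.take_append_of_le_length hge])
  · exact key_fact (by rw [← e]; exact hc) (by rw [e])

end Tree

lemma exists_stable_of_antitone {α : Type*} [LinearOrder α] [WellFoundedLT α] {f : ℕ → α} {a : ℕ}
    (h : ∀ t ≥ a, f (t + 1) ≤ f t) : ∃ b ≥ a, ∀ t ≥ b, f t = f b := by
  obtain ⟨_, ⟨b, hb, rfl⟩, hmin⟩ :=
    (wellFounded_lt (α := α)).has_min (f '' Set.Ici a) ⟨_, a, Set.mem_Ici.2 le_rfl, rfl⟩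
  refine ⟨b, hb, fun t ht => le_antisymm ?_ (not_lt.1 (hmin _ ⟨t, le_trans hb ht, rfl⟩))⟩
  induction t, ht using Nat.le_induction with
  | base => exact le_rfl
  | succ t ht ih => exact (h t (le_trans hb ht)).trans ih

/-- König's lemma for a finitely branching forest given by predecessors. -/
lemma exists_infinite_branch [Finite Q] {P : ℕ → Set Q} {r : ℕ → Q → Q → Prop}
    (hne : ∀ t, (P t).Nonempty) (hr : ∀ t, ∀ q ∈ P (t + 1), ∃ p ∈ P t, r t p q) :
    ∃ ρ : ℕ → Q, ∀ t, ρ t ∈ P t ∧ r t (ρ t) (ρ (t + 1)) := by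
  have hfin : ∀ m, ∀ q ∈ P m, ∃ σ : ℕ → Q, σ m = q ∧
      ∀ t < m, σ t ∈ P t ∧ r t (σ t) (σ (t + 1)) := by
    intro m
    induction m with
    | zero => exact fun q _ => ⟨fun _ => q, rfl, fun t ht => absurd ht (Nat.not_lt_zero t)⟩
    | succ m ih =>
      intro q hq
      obtain ⟨p, hp, hpq⟩ := hr m q hq
      obtain ⟨σ, hσ, h⟩ := ih p hp
      refine ⟨Function.update σ (m + 1) q, Function.update_self .., fun t ht => ?_⟩
      rw [Function.update_of_ne ht.ne]
      rcases (Nat.lt_succ_iff.1 ht).lt_or_eq with hlt | rfl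
      · rw [Function.update_of_ne (by omega)]
        exact h t hlt
      · rw [Function.update_self, hσ]
        exact ⟨hp, hpq⟩
  choose q hq using hne
  choose σ _ hσ using fun m => hfin m (q m) (hq m)
  let U : Ultrafilter ℕ := Filter.hyperfilter ℕ
  have hlim : ∀ t, ∃ p, ∀ᶠ m in (U : Filter ℕ), σ m t = p := by
    intro t
    obtain ⟨p, hp⟩ := Ultrafilter.eq_pure_of_finite (U.map fun m => σ m t)
    refine ⟨p, ?_⟩
    have : ({p} : Set Q) ∈ U.map fun m => σ m t := by rw [hp]; exact Set.mem_singleton p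
    exact this
  choose ρ hρ using hlim
  refine ⟨ρ, fun t => ?_⟩
  have hlarge : ∀ᶠ m in (U : Filter ℕ), t < m :=
    (Nat.hyperfilter_le_atTop : (U : Filter ℕ) ≤ atTop) (eventually_gt_atTop t)
  obtain ⟨m, h1, h2, h3⟩ := ((hρ t).and ((hρ (t + 1)).and hlarge)).exists
  rw [← h1, ← h2]
  exact hσ m t h3

lemma label_le_of_key_le {k : ℕ} {x y : List ℕ} (ha : Agree k x y) (h : key x ≤ key y) :
    label x k ≤ label y k := by
  by_contra! hlt
  exact (not_lt.2 h) (key_lt.2 ⟨k, ha.symm, hlt⟩)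

/-- The sequence of history trees for a sequence of transition relations. -/
noncomputable def trees (T : ℕ → Q → Set Q) (F : Set Q) (q₀ : Q) : ℕ → Tree Q
  | 0 => ⟨0, {q₀}, fun _ => []⟩
  | t + 1 => (trees T F q₀ t).step (T t) F

variable {T : ℕ → Q → Set Q} {F : Set Q} {q₀ : Q}

lemma trees_valid [Finite Q] (T : ℕ → Q → Set Q) (F : Set Q) (q₀ : Q) (t : ℕ) :
    (trees T F q₀ t).Valid := by
  induction t with
  | zero => exact ⟨fun q hq k _ => ⟨q, hq, by simp [trees]⟩, fun q _ a ha => by simp [trees] at ha⟩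
  | succ t ih => exact ih.step

/-- The node `v` absorbs its descendants in the transition after time `t`. -/
def FlashAt (T : ℕ → Q → Set Q) (F : Set Q) (q₀ : Q) (v : List ℕ) (t : ℕ) : Prop :=
  ∃ q ∈ (trees T F q₀ (t + 1)).live, (trees T F q₀ (t + 1)).path q = v ∧
    (trees T F q₀ t).Flash (T t) F q

/-- The node `v` is present at time `t`. -/
def AliveAt (T : ℕ → Q → Set Q) (F : Set Q) (q₀ : Q) (v : List ℕ) (t : ℕ) : Prop :=
  v ∈ (trees T F q₀ t).path '' (trees T F q₀ t).live

/-- A node that stays alive and flashes infinitely often gives rise to an accepting run. -/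
lemma exists_run_of_flash [Finite Q] {v : List ℕ} (ha : ∀ᶠ t in atTop, AliveAt T F q₀ v t)
    (hf : ∃ᶠ t in atTop, FlashAt T F q₀ v t) :
    ∃ ρ : ℕ → Q, (ρ 0 = q₀ ∧ ∀ t, ρ (t + 1) ∈ T t (ρ t)) ∧ ∃ᶠ t in atTop, ρ t ∈ F := by
  obtain ⟨a, ha⟩ := eventually_atTop.1 ha
  set s := trees T F q₀
  obtain ⟨ρ, hρ⟩ := exists_infinite_branch
    (P := fun t => {q | q ∈ (s t).live ∧ (a ≤ t → Agree v.length v ((s t).path q))})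
    (r := fun t p q => q ∈ (s (t + 1)).live ∧ p = (s t).parent (T t) q)
    (fun t => by
      obtain ⟨q, hq⟩ : ∃ q, q ∈ (s t).live := by
        have hmax := ha (max a t) (le_max_left _ _)
        have hback : ∀ d, ∀ q ∈ (s (t + d)).live, ∃ p, p ∈ (s t).live := by
          intro d
          induction d with
          | zero => exact fun q hq => ⟨q, hq⟩
          | succ d ih => exact fun q hq => ih _ (Tree.parent_spec (s := s (t + d)) hq).1.1
        obtain ⟨q, hq, -⟩ := hmax
        refine hback (max a t - t) q ?_
        rwa [Nat.add_sub_cancel' (le_max_right a t)]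
      by_cases hat : a ≤ t
      · obtain ⟨q, hq, e⟩ := ha t hat
        exact ⟨q, hq, fun _ => by rw [← e]; exact Agree.refl _ _⟩
      · exact ⟨q, hq, fun h => (hat h).elim⟩)
    (fun t q hq => by
      refine ⟨(s t).parent (T t) q, ⟨(Tree.parent_spec (s := s t) hq.1).1.1, fun hat => ?_⟩,
        hq.1, rfl⟩
      exact (trees_valid T F q₀ t).agree_parent (ha t hat) (hq.2 (by omega)))
  refine ⟨ρ, ⟨(hρ 0).1.1, fun t => ?_⟩, ?_⟩
  · obtain ⟨h1, h2⟩ := (hρ t).2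
    have := (Tree.parent_spec (s := s t) h1).1.2
    rwa [← h2] at this
  · by_contra hn
    obtain ⟨b, hb⟩ := eventually_atTop.1 (not_frequently.1 hn)
    obtain ⟨t₁, ht₁, q, hq, hqv, hqf⟩ := frequently_atTop.1 hf (max a b)
    have hstay : ∀ t, max a b ≤ t → (s t).path (ρ t) = v →
        (s t).raw (T t) F (ρ (t + 1)) = v ∧ (s (t + 1)).path (ρ (t + 1)) = v := by
      intro t ht e
      have hraw : (s t).raw (T t) F (ρ (t + 1)) = v := by
        rcases Tree.raw_cases (T t) F (s t) (ρ (t + 1)) with ⟨hF, -⟩ | ⟨-, e'⟩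
        · exact (hb (t + 1) (by omega) hF).elim
        · rw [e', ← (hρ t).2.2, e]
      refine ⟨hraw, (Agree.eq ?_ ((hρ (t + 1)).1.2 (by omega))).symm⟩
      refine le_antisymm (((hρ (t + 1)).1.2 (by omega)).length_le le_rfl) ?_
      rw [← hraw]
      exact (Tree.length_step (s := s t) _).trans_le (cut_le _ _ _)
    have hstart : (s (t₁ + 1)).path (ρ (t₁ + 1)) = v := by
      have hag := (hρ (t₁ + 1)).1.2 (by omega)
      refine (Agree.eq (le_antisymm (hag.length_le le_rfl) ?_) hag).symm
      have hlen : cut ((s t₁).succ (T t₁)) ((s t₁).raw (T t₁) F) q = v.length := by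
        rw [← hqv]
        exact (Tree.length_step (s := s t₁) q).symm
      refine (Tree.length_step (s := s t₁) _).trans_le ?_
      by_contra! hlt
      obtain ⟨p, hp, hpl, hpa⟩ := exists_of_lt_cut hlt
      rcases cut_spec ((s t₁).succ (T t₁)) ((s t₁).raw (T t₁) F) q with h | h
      · exact (not_lt.2 h) (Tree.flash_iff.1 hqf)
      · rw [hlen] at h
        have h1 : Agree v.length v ((s t₁).raw (T t₁) F q) :=
          Tree.agree_raw (by rw [← hqv]; exact Agree.refl _ _)
        exact h ⟨p, hp, hpl, (hpa.trans (Tree.agree_raw hag).symm).trans h1⟩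
    have hconst : ∀ t ≥ t₁ + 1, (s t).path (ρ t) = v := by
      intro t ht
      induction t, ht using Nat.le_induction with
      | base => exact hstart
      | succ t ht ih => exact (hstay t (by omega) ih).2
    obtain ⟨t₂, ht₂, q, hq, hqv, hqf⟩ := frequently_atTop.1 hf (t₁ + 1)
    have hraw := (hstay t₂ (by omega) (hconst t₂ ht₂)).1
    have hlen : cut ((s t₂).succ (T t₂)) ((s t₂).raw (T t₂) F) q = v.length := by
      rw [← hqv]
      exact (Tree.length_step (s := s t₂) q).symm
    rcases cut_spec ((s t₂).succ (T t₂)) ((s t₂).raw (T t₂) F) q with h | h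
    · exact (not_lt.2 h) (Tree.flash_iff.1 hqf)
    · rw [hlen] at h
      have h1 : Agree v.length v ((s t₂).raw (T t₂) F q) :=
        Tree.agree_raw (by rw [← hqv]; exact Agree.refl _ _)
      exact h ⟨ρ (t₂ + 1), (hρ t₂).2.1, by rw [hraw], by rw [hraw]; exact h1⟩

/-- An accepting run gives rise to a node that stays alive and flashes infinitely often. -/
lemma exists_flash_of_run [Finite Q] {ρ : ℕ → Q} (h0 : ρ 0 = q₀)
    (hρ : ∀ t, ρ (t + 1) ∈ T t (ρ t)) (hF : ∃ᶠ t in atTop, ρ t ∈ F) :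
    ∃ v, (∀ᶠ t in atTop, AliveAt T F q₀ v t) ∧ ∃ᶠ t in atTop, FlashAt T F q₀ v t := by
  set s := trees T F q₀
  have hs := trees_valid T F q₀
  have hlive : ∀ t, ρ t ∈ (s t).live := by
    intro t
    induction t with
    | zero => exact h0
    | succ t ih => exact ⟨ρ t, ih, hρ t⟩
  by_contra! hno
  have hall : ∀ k, ∃ v : List ℕ, v.length = k ∧
      ∀ᶠ t in atTop, Agree v.length v ((s t).path (ρ t)) := by
    intro k
    induction k with
    | zero => exact ⟨[], rfl, .of_forall fun t i hi => absurd hi (Nat.not_lt_zero i)⟩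
    | succ k ih =>
      obtain ⟨v, rfl, hv⟩ := ih
      have hflash := hno v (hv.mono fun t h => (hs t).mem_image_of_agree (hlive t) h)
      obtain ⟨a, ha⟩ := eventually_atTop.1 (hv.and hflash)
      have hgrow : ∀ t ≥ a, v.length < ((s t).raw (T t) F (ρ (t + 1))).length →
          v.length < ((s (t + 1)).path (ρ (t + 1))).length := by
        intro t ht hlt
        have hag := (ha (t + 1) (by omega)).1
        refine lt_of_le_of_ne (hag.length_le le_rfl) fun e => ?_
        have e' := Agree.eq e hag
        refine (ha t ht).2 ⟨ρ (t + 1), hlive (t + 1), e'.symm, fun e'' => ?_⟩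
        rw [← e''] at hlt
        exact hlt.ne e
      have hpar : ∀ t ≥ a, Agree v.length v ((s t).path ((s t).parent (T t) (ρ (t + 1)))) :=
        fun t ht => (hs t).agree_parent ((hs t).mem_image_of_agree (hlive t) (ha t ht).1)
          (ha (t + 1) (by omega)).1
      have hdesc : ∀ t ≥ a, v.length < ((s t).path (ρ t)).length →
          v.length < ((s (t + 1)).path (ρ (t + 1))).length ∧
          label ((s (t + 1)).path (ρ (t + 1))) v.length ≤ label ((s t).path (ρ t)) v.length := by
        intro t ht hlt
        have hkey := (Tree.parent_spec (s := s t) (hlive (t + 1))).2 (ρ t) ⟨hlive t, hρ t⟩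
        have hle := label_le_of_key_le ((hpar t ht).symm.trans (ha t ht).1) hkey
        have hplt := label_lt_top.1 (hle.trans_lt (label_lt_top.2 hlt))
        have hg := hgrow t ht (hplt.trans_le (Tree.length_parent_le_raw _))
        refine ⟨hg, ?_⟩
        change label (((s t).raw (T t) F (ρ (t + 1))).take _) _ ≤ _
        rw [label_take, if_pos ((Tree.length_step (s := s t) _).symm ▸ hg), Tree.label_raw hplt]
        exact hle
      obtain ⟨b, hb, hbF⟩ := frequently_atTop.1 hF (a + 1)
      obtain ⟨b, rfl⟩ := Nat.exists_eq_add_of_le' (show 1 ≤ b by omega)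
      have hstart : v.length < ((s (b + 1)).path (ρ (b + 1))).length := by
        refine hgrow b (by omega) ?_
        rcases Tree.raw_cases (T b) F (s b) (ρ (b + 1)) with ⟨-, e⟩ | ⟨hn, -⟩
        · rw [e, List.length_append, List.length_singleton, Nat.lt_succ_iff]
          exact (hpar b (by omega)).length_le le_rfl
        · exact (hn hbF).elim
      have hlong : ∀ t ≥ b + 1, v.length < ((s t).path (ρ t)).length := by
        intro t ht
        induction t, ht using Nat.le_induction with
        | base => exact hstart
        | succ t ht ih => exact (hdesc t (by omega) ih).1
      obtain ⟨c, hc, hconst⟩ := exists_stable_of_antitone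
        (f := fun t => label ((s t).path (ρ t)) v.length) (a := b + 1)
        (fun t ht => (hdesc t (by omega) (hlong t ht)).2)
      have hlen : (((s c).path (ρ c)).take (v.length + 1)).length = v.length + 1 :=
        List.length_take_of_le (hlong c hc)
      refine ⟨((s c).path (ρ c)).take (v.length + 1), hlen,
        eventually_atTop.2 ⟨c, fun t ht => ?_⟩⟩
      rw [hlen]
      refine agree_take_left.trans fun i hi => ?_
      rcases (Nat.lt_succ_iff.1 hi).lt_or_eq with hlt | rfl
      · rw [← (ha c (by omega)).1 i hlt, (ha t (by omega)).1 i hlt]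
      · exact (hconst t ht).symm
  obtain ⟨v, hv, hev⟩ := hall (Nat.card Q)
  obtain ⟨t, ht⟩ := hev.exists
  have h1 := ht.length_le le_rfl
  have h2 : ((s t).path (ρ t)).length < Nat.card Q := (hs t).length_lt (hlive t)
  omega

lemma exists_name_of_alive [Finite Q] {v : List ℕ} (ha : ∀ᶠ t in atTop, AliveAt T F q₀ v t) :
    ∃ N, ∀ᶠ t in atTop, (trees T F q₀ t).name v = N := by
  obtain ⟨a, ha⟩ := eventually_atTop.1 ha
  have h : ∀ j, ∃ c, j ∈ Finset.range (v.length + 1) →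
      ∀ᶠ t in atTop, ((trees T F q₀ t).elders v j).ncard = c := by
    intro j
    by_cases hj : j ∈ Finset.range (v.length + 1)
    · obtain ⟨b, -, hb⟩ := exists_stable_of_antitone
        (f := fun t => ((trees T F q₀ t).elders v j).ncard) (a := a) fun t ht =>
          Set.ncard_le_ncard ((trees_valid T F q₀ t).elders_step_subset (ha t ht)
            (Nat.lt_succ_iff.1 (Finset.mem_range.1 hj))) (Tree.finite_elders _ _ _)
      exact ⟨_, fun _ => eventually_atTop.2 ⟨b, hb⟩⟩
    · exact ⟨0, fun h => (hj h).elim⟩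
  choose c hc using h
  refine ⟨(Finset.range (v.length + 1)).image c, ?_⟩
  filter_upwards [(Filter.eventually_all_finset _).2 hc] with t ht
  exact Finset.image_congr fun j hj => ht j hj

/-- Acceptance in terms of names of nodes. -/
lemma exists_flash_iff_exists_name [Finite Q] :
    (∃ v, (∀ᶠ t in atTop, AliveAt T F q₀ v t) ∧ ∃ᶠ t in atTop, FlashAt T F q₀ v t) ↔
    ∃ N : Finset ℕ, N ⊆ Finset.range (Nat.card Q + 1) ∧
      (∃ᶠ t in atTop, ∃ q ∈ (trees T F q₀ (t + 1)).live,
        (trees T F q₀ (t + 1)).name ((trees T F q₀ (t + 1)).path q) = N ∧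
          (trees T F q₀ t).Flash (T t) F q) ∧
      ∀ᶠ t in atTop, ∃ q ∈ (trees T F q₀ (t + 1)).live,
        (trees T F q₀ (t + 1)).name ((trees T F q₀ (t + 1)).path q) = N ∧
          (trees T F q₀ t).Stable (T t) F q := by
  constructor
  · rintro ⟨v, ha, hf⟩
    obtain ⟨N, hN⟩ := exists_name_of_alive ha
    have hN' := (tendsto_add_atTop_nat 1).eventually hN
    have ha' := (tendsto_add_atTop_nat 1).eventually ha
    refine ⟨N, ?_, ?_, ?_⟩
    · obtain ⟨t, ht⟩ := hN.exists
      exact ht ▸ Tree.name_subset _ _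
    · refine (hf.and_eventually hN').mono ?_
      rintro t ⟨⟨q, hq, rfl, hqf⟩, e⟩
      exact ⟨q, hq, e, hqf⟩
    · filter_upwards [hN, hN', ha, ha'] with t h1 h2 h3 h4
      obtain ⟨q, hq, rfl⟩ := h4
      obtain ⟨p, hp, e⟩ := h3
      exact ⟨q, hq, h2, p, hp, e, by rw [e]; exact h1.trans h2.symm⟩
  · rintro ⟨N, -, hf, hst⟩
    obtain ⟨a, ha⟩ := eventually_atTop.1 hst
    obtain ⟨q, hq, hqN, p, hp, hpq, hname⟩ := ha a le_rfl
    have hall : ∀ t ≥ a, AliveAt T F q₀ ((trees T F q₀ a).path p) t ∧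
        (trees T F q₀ t).name ((trees T F q₀ a).path p) = N := by
      intro t ht
      induction t, ht using Nat.le_induction with
      | base => exact ⟨⟨p, hp, rfl⟩, hname.trans hqN⟩
      | succ t ht ih =>
        obtain ⟨q, hq, hqN, r, hr, hrq, hname⟩ := ha t ht
        have e := (trees_valid T F q₀ t).name_injOn ⟨r, hr, rfl⟩ ih.1
          ((hname.trans hqN).trans ih.2.symm)
        rw [← e]
        exact ⟨⟨q, hq, hrq.symm⟩, by rw [hrq]; exact hqN⟩
    refine ⟨(trees T F q₀ a).path p, eventually_atTop.2 ⟨a, fun t ht => (hall t ht).1⟩, ?_⟩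
    refine (hf.and_eventually (eventually_ge_atTop a)).mono ?_
    rintro t ⟨⟨q, hq, hqN, hqf⟩, ht⟩
    obtain ⟨h1, h2⟩ := hall (t + 1) (by omega)
    exact ⟨q, hq, (trees_valid T F q₀ (t + 1)).name_injOn ⟨q, hq, rfl⟩ h1 (hqN.trans h2.symm), hqf⟩

/-- The states of the deterministic automaton: codes of history trees, with the sets of states
whose nodes flashed and were stable, respectively, in the last transition. -/
abbrev State (Q : Type) [Finite Q] : Type :=
  (Q → Fin (3 * Nat.card Q + 1)) × (Q → Bool) × (Q → Bool)

open Classical in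
/-- The state reached by a transition from a history tree. -/
noncomputable def nextState [Finite Q] (T : Q → Set Q) (F : Set Q) (s : Tree Q) : State Q :=
  ((s.step T F).code, fun q => decide (q ∈ s.succ T ∧ s.Flash T F q),
    fun q => decide (q ∈ s.succ T ∧ s.Stable T F q))

/-- A history tree with a given code. -/
noncomputable def decode [Finite Q] (c : Q → Fin (3 * Nat.card Q + 1)) : Tree Q :=
  haveI : Nonempty (Tree Q) := ⟨⟨0, ∅, fun _ => []⟩⟩
  Classical.epsilon fun s => s.Valid ∧ s.code = c

lemma nextState_decode [Finite Q] (T : Q → Set Q) (F : Set Q) {s : Tree Q} (hs : s.Valid) :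
    nextState T F (decode s.code) = nextState T F s := by
  have : Nonempty (Tree Q) := ⟨s⟩
  obtain ⟨hd, hc⟩ : (decode s.code).Valid ∧ (decode s.code).code = s.code :=
    Classical.epsilon_spec (p := fun s' : Tree Q => s'.Valid ∧ s'.code = s.code) ⟨s, hs, rfl⟩
  obtain ⟨hl, h⟩ := hd.of_code_eq hs hc
  unfold nextState
  refine Prod.ext (Tree.code_congr (Tree.succ_congr hl) (Tree.sameShape_step hd hs hl h))
    (Prod.ext (funext fun q => ?_) (funext fun q => ?_))
  · simp only [decide_eq_decide, ← Tree.succ_congr hl]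
    exact and_congr_right fun hq => Tree.flash_congr hd hs hl h hq
  · simp only [decide_eq_decide, ← Tree.succ_congr hl]
    exact and_congr_right fun hq => Tree.stable_congr hd hs hl h hq

/-- The tree coded by the first component has a node with name `N` hosting a state flagged
by `f`. -/
def Flagged [Finite Q] (N : Finset ℕ) (c : Q → Fin (3 * Nat.card Q + 1)) (f : Q → Bool) : Prop :=
  ∃ s : Tree Q, s.Valid ∧ s.code = c ∧ ∃ q ∈ s.live, s.name (s.path q) = N ∧ f q = true

lemma flagged_code [Finite Q] {N : Finset ℕ} {s : Tree Q} (hs : s.Valid) {f : Q → Bool} :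
    Flagged N s.code f ↔ ∃ q ∈ s.live, s.name (s.path q) = N ∧ f q = true := by
  refine ⟨?_, fun h => ⟨s, hs, rfl, h⟩⟩
  rintro ⟨s', hs', hc, q, hq, hN, hf⟩
  obtain ⟨hl, h⟩ := hs'.of_code_eq hs hc
  exact ⟨q, hl ▸ hq, Tree.name_congr hl h hq ▸ hN, hf⟩

/-- The Rabin pair for a name. -/
def rabinPair (Q : Type) [Finite Q] (N : Finset ℕ) : Set (State Q) × Set (State Q) :=
  ({d | ¬ Flagged N d.1 d.2.2}, {d | Flagged N d.1 d.2.1})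

open Classical in
/-- The determinization of a Büchi automaton by history trees. -/
noncomputable def automaton {A : Type} (B : NBA A) : DRA A where
  Q := State B.Q
  δ d a := nextState (fun q => B.Δ q a) B.F (decode d.1)
  qI := ((⟨0, {B.qI}, fun _ => []⟩ : Tree B.Q).code, fun _ => false, fun _ => false)
  R := (Finset.range (Nat.card B.Q + 1)).powerset.image (rabinPair B.Q)

variable {A : Type} (B : NBA A) (w : ℕ → A)

/-- The sequence of history trees of an automaton on a word. -/
noncomputable abbrev wordTrees : ℕ → Tree B.Q := trees (fun t q => B.Δ q (w t)) B.F B.qI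

lemma run_fst (t : ℕ) : ((automaton B).run w t).1 = (wordTrees B w t).code := by
  induction t with
  | zero => rfl
  | succ t ih =>
    change (nextState _ _ (decode ((automaton B).run w t).1)).1 = _
    rw [ih, nextState_decode _ _ (trees_valid _ _ _ t)]
    rfl

lemma run_succ (t : ℕ) : (automaton B).run w (t + 1) =
    nextState (fun q => B.Δ q (w t)) B.F (wordTrees B w t) := by
  change nextState _ _ (decode ((automaton B).run w t).1) = _
  rw [run_fst, nextState_decode _ _ (trees_valid _ _ _ t)]

lemma run_mem_rabinPair_snd (N : Finset ℕ) (t : ℕ) :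
    (automaton B).run w (t + 1) ∈ (rabinPair B.Q N).2 ↔
      ∃ q ∈ (wordTrees B w (t + 1)).live,
        (wordTrees B w (t + 1)).name ((wordTrees B w (t + 1)).path q) = N ∧
          (wordTrees B w t).Flash (fun q => B.Δ q (w t)) B.F q := by
  rw [run_succ]
  refine (flagged_code (trees_valid _ _ _ (t + 1))).trans (exists_congr fun q =>
    and_congr_right fun hq => and_congr_right fun _ => ?_)
  simp only [nextState, decide_eq_true_eq]
  exact and_iff_right hq

lemma run_notMem_rabinPair_fst (N : Finset ℕ) (t : ℕ) :
    (automaton B).run w (t + 1) ∉ (rabinPair B.Q N).1 ↔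
      ∃ q ∈ (wordTrees B w (t + 1)).live,
        (wordTrees B w (t + 1)).name ((wordTrees B w (t + 1)).path q) = N ∧
          (wordTrees B w t).Stable (fun q => B.Δ q (w t)) B.F q := by
  rw [run_succ]
  refine not_not.trans ((flagged_code (trees_valid _ _ _ (t + 1))).trans (exists_congr fun q =>
    and_congr_right fun hq => and_congr_right fun _ => ?_))
  simp only [nextState, decide_eq_true_eq]
  exact and_iff_right hq

lemma automaton_accepts_iff : (automaton B).Accepts w ↔ B.Accepts w := by
  have h : B.Accepts w ↔ ∃ v, (∀ᶠ t in atTop, AliveAt (fun t q => B.Δ q (w t)) B.F B.qI v t) ∧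
      ∃ᶠ t in atTop, FlashAt (fun t q => B.Δ q (w t)) B.F B.qI v t :=
    ⟨fun ⟨_, ⟨h0, hρ⟩, hF⟩ => exists_flash_of_run h0 hρ hF,
      fun ⟨_, ha, hf⟩ => exists_run_of_flash ha hf⟩
  rw [h, exists_flash_iff_exists_name]
  simp only [DRA.Accepts]
  constructor
  · rintro ⟨_, hp, h1, h2⟩
    obtain ⟨N, hN, rfl⟩ := Finset.mem_image.1 hp
    rw [← map_add_atTop_eq_nat 1, frequently_map] at h1
    rw [← map_add_atTop_eq_nat 1, eventually_map] at h2
    exact ⟨N, Finset.mem_powerset.1 hN, h1.mono fun t => (run_mem_rabinPair_snd B w N t).1,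
      h2.mono fun t => (run_notMem_rabinPair_fst B w N t).1⟩
  · rintro ⟨N, hN, h1, h2⟩
    refine ⟨_, Finset.mem_image_of_mem _ (Finset.mem_powerset.2 hN), ?_, ?_⟩
    · rw [← map_add_atTop_eq_nat 1, frequently_map]
      exact h1.mono fun t => (run_mem_rabinPair_snd B w N t).2
    · rw [← map_add_atTop_eq_nat 1, eventually_map]
      exact h2.mono fun t => (run_notMem_rabinPair_fst B w N t).2

lemma card_bound {n : ℕ} (hn : 1 ≤ n) :
    (3 * n + 1) ^ n * (2 ^ n * 2 ^ n) ≤ 6 ^ (2 * n - 1) * (n + 1) ^ (n + 1) := by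
  have h1 : (3 * n + 1) ^ n ≤ 3 ^ n * (n + 1) ^ n := by
    rw [← mul_pow]
    exact Nat.pow_le_pow_left (by omega) n
  have h2 : 6 * 12 ^ n ≤ 36 ^ n * (n + 1) := by
    have h3 : 3 ≤ 3 ^ n := Nat.le_self_pow (by omega) 3
    have h4 : 6 ≤ 3 ^ n * (n + 1) := by nlinarith
    calc 6 * 12 ^ n ≤ (3 ^ n * (n + 1)) * 12 ^ n := Nat.mul_le_mul_right _ h4
      _ = 36 ^ n * (n + 1) := by rw [show 36 = 3 * 12 by norm_num, mul_pow]; ring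
  have h5 : 6 * 6 ^ (2 * n - 1) = 36 ^ n := by
    rw [← pow_succ', show 2 * n - 1 + 1 = 2 * n by omega, pow_mul]
    norm_num
  have h6 : (3 : ℕ) ^ n * (2 ^ n * 2 ^ n) = 12 ^ n := by
    rw [← mul_pow, ← mul_pow]
    norm_num
  refine Nat.le_of_mul_le_mul_left ?_ (show 0 < 6 by norm_num)
  calc 6 * ((3 * n + 1) ^ n * (2 ^ n * 2 ^ n))
      ≤ 6 * ((3 ^ n * (n + 1) ^ n) * (2 ^ n * 2 ^ n)) := by gcongr
    _ = (6 * 12 ^ n) * (n + 1) ^ n := by rw [← h6]; ring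
    _ ≤ (36 ^ n * (n + 1)) * (n + 1) ^ n := Nat.mul_le_mul_right _ h2
    _ = 6 * (6 ^ (2 * n - 1) * (n + 1) ^ (n + 1)) := by rw [← h5]; ring

lemma card_state (Q : Type) [Fintype Q] : Nat.card (State Q) =
    (3 * Fintype.card Q + 1) ^ Fintype.card Q *
      (2 ^ Fintype.card Q * 2 ^ Fintype.card Q) := by
  simp [State, Nat.card_prod, Nat.card_fun, Nat.card_eq_fintype_card]

end HistoryTree

/-- Determinization of Büchi automata into Rabin automata with at most
`6^(2n-1) * (n+1)^(n+1)` states and `2^(n+1)` Rabin pairs. -/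
theorem nba_to_dra_size (A : Type) [Fintype A] [Nonempty A] (B : NBA A)
    (hn : 1 ≤ Fintype.card B.Q) :
    ∃ D : DRA A,
      (∀ w : ℕ → A, B.Accepts w ↔ D.Accepts w) ∧
      Fintype.card D.Q ≤
        6 ^ (2 * Fintype.card B.Q - 1) * (Fintype.card B.Q + 1) ^ (Fintype.card B.Q + 1) ∧
      D.R.card ≤ 2 ^ (Fintype.card B.Q + 1) := by
  refine ⟨HistoryTree.automaton B, fun w => (HistoryTree.automaton_accepts_iff B w).symm, ?_, ?_⟩
  · rw [← Nat.card_eq_fintype_card]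
    exact (HistoryTree.card_state B.Q).trans_le (HistoryTree.card_bound hn)
  · refine Finset.card_image_le.trans ?_
    rw [Finset.card_powerset, Finset.card_range, Nat.card_eq_fintype_card]
end
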